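/- arXiv:1902.10258 — 8 statements merged into one kernel-verified Lean document; each statement's English description precedes it below -/
import Mathlib

section
/- For every integer t ≥ 2 and every positive integer n, the maximum number of edges in a 3-uniform hypergraph on n vertices containing no copy of K_{2,t}^{(3)} satisfies ex(n, K_{2,t}^{(3)}) ≤ (15·t·log t + 40·t)·n², where log denotes the base-2 logarithm. -/
/-- A 3-uniform hypergraph `H` (given as a finite set of edges, each a `Finset` of
vertices) contains a copy of `K_{2,t}^{(3)}`: there are distinct vertices
`a, b, x_1, …, x_t, y_1, …, y_t` (i.e. `2t+2` distinct vertices) such that all the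
triples `{a, x i, y i}` and `{b, x i, y i}` are edges of `H`. -/
def hasK2t3 {V : Type*} [DecidableEq V] (t : ℕ) (H : Finset (Finset V)) : Prop :=
  ∃ (a b : V) (x y : Fin t → V),
    ({a, b} ∪ Finset.image x Finset.univ ∪ Finset.image y Finset.univ).card = 2 * t + 2 ∧
    ∀ i : Fin t,
      ({a, x i, y i} : Finset V) ∈ H ∧ ({b, x i, y i} : Finset V) ∈ H

theorem aux_match {V : Type*} [DecidableEq V] (G : Finset (V × V)) (hG : ∀ p ∈ G, p.1 ≠ p.2)
    (t : ℕ) :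
    (∃ x y : Fin t → V, (Finset.image x Finset.univ ∪ Finset.image y Finset.univ).card = 2 * t ∧
      ∀ i, (x i, y i) ∈ G) ∨
    ∃ C : Finset V, C.card ≤ 2 * t ∧ ∀ p ∈ G, p.1 ∈ C ∨ p.2 ∈ C := by
  induction t with
  | zero =>
    left
    exact ⟨Fin.elim0, Fin.elim0, by simp, fun i => i.elim0⟩
  | succ t ih =>
    rcases ih with ⟨x, y, hc, hm⟩ | ⟨C, hC, hcov⟩
    · by_cases h : ∀ p ∈ G, p.1 ∈ (Finset.image x Finset.univ ∪ Finset.image y Finset.univ) ∨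
          p.2 ∈ (Finset.image x Finset.univ ∪ Finset.image y Finset.univ)
      · right
        exact ⟨_, by omega, h⟩
      · left
        push Not at h
        obtain ⟨⟨p, q⟩, hp, h1, h2⟩ := h
        refine ⟨Fin.cons p x, Fin.cons q y, ?_, ?_⟩
        · have : (Finset.image (Fin.cons p x : Fin (t+1) → V) Finset.univ ∪
              Finset.image (Fin.cons q y : Fin (t+1) → V) Finset.univ) =
              insert p (insert q (Finset.image x Finset.univ ∪ Finset.image y Finset.univ)) := by
            ext v
            simp only [Finset.mem_union, Finset.mem_image, Finset.mem_univ, true_and,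
              Finset.mem_insert, Fin.exists_fin_succ, Fin.cons_zero, Fin.cons_succ]
            rw [eq_comm (a := p), eq_comm (a := q)]
            tauto
          rw [this, Finset.card_insert_of_notMem, Finset.card_insert_of_notMem h2, hc]
          · omega
          · rw [Finset.mem_insert, not_or]
            exact ⟨hG _ hp, h1⟩
        · intro i
          refine Fin.cases ?_ ?_ i
          · simpa using hp
          · intro j
            simpa using hm j
    · right
      exact ⟨C, by omega, hcov⟩

/-- codegree -/
def cdg {n : ℕ} (H : Finset (Finset (Fin n))) (x y : Fin n) : ℕ :=
  (Finset.univ.filter (fun a => ({a, x, y} : Finset (Fin n)) ∈ H)).card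

/-- edge with maximal pair x y -/
def SS {n : ℕ} (H : Finset (Finset (Fin n))) (a x y : Fin n) : Prop :=
  ({a, x, y} : Finset (Fin n)) ∈ H ∧ cdg H a x ≤ cdg H x y ∧ cdg H a y ≤ cdg H x y

instance {n : ℕ} (H : Finset (Finset (Fin n))) (a x y : Fin n) : Decidable (SS H a x y) := by
  unfold SS; infer_instance

theorem cdg_comm {n : ℕ} (H : Finset (Finset (Fin n))) (x y : Fin n) : cdg H x y = cdg H y x := by
  unfold cdg
  congr 1
  ext a
  simp [Finset.pair_comm x y]

theorem SS_comm {n : ℕ} (H : Finset (Finset (Fin n))) (a x y : Fin n) (h : SS H a x y) :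
    SS H a y x := by
  obtain ⟨h1, h2, h3⟩ := h
  refine ⟨by rwa [Finset.pair_comm y x], ?_, ?_⟩
  · rwa [cdg_comm H y x]
  · rwa [cdg_comm H y x]

theorem ne_of_card {n : ℕ} {a x y : Fin n} (h : ({a, x, y} : Finset (Fin n)).card = 3) :
    a ≠ x ∧ a ≠ y ∧ x ≠ y := by
  refine ⟨?_, ?_, ?_⟩ <;> rintro rfl
  · have := Finset.card_le_two (a := a) (b := y)
    simp at h; omega
  · have := Finset.card_le_two (a := x) (b := a)
    rw [Finset.pair_comm x a, Finset.insert_idem, Finset.pair_comm] at h; omega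
  · have := Finset.card_le_two (a := a) (b := x)
    simp at h; omega

theorem inner_le {n : ℕ} (H : Finset (Finset (Fin n))) (a c : Fin n) (D : Finset (Fin n))
    (hD : ∀ y ∈ D, SS H a c y) : ∑ y ∈ D, (1 : ℝ) / cdg H c y ≤ 1 := by
  rcases D.eq_empty_or_nonempty with rfl | hne
  · simp
  have hpos : (0 : ℝ) < D.card := by exact_mod_cast hne.card_pos
  have hle : D.card ≤ cdg H a c := by
    unfold cdg
    apply Finset.card_le_card
    intro y hy
    have := (hD y hy).1
    simp only [Finset.mem_filter, Finset.mem_univ, true_and]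
    convert this using 1
    ext v; simp; tauto
  calc ∑ y ∈ D, (1 : ℝ) / cdg H c y ≤ ∑ y ∈ D, (1 : ℝ) / D.card := by
        apply Finset.sum_le_sum
        intro y hy
        apply one_div_le_one_div_of_le hpos
        exact_mod_cast hle.trans (hD y hy).2.1
    _ = 1 := by
        rw [Finset.sum_const, nsmul_eq_mul]
        field_simp

theorem pair_le {t n : ℕ} (H : Finset (Finset (Fin n))) (h3 : ∀ e ∈ H, e.card = 3)
    (hfree : ¬ hasK2t3 t H) (a b : Fin n) (hab : a ≠ b) :
    ∑ p ∈ Finset.univ.filter (fun p : Fin n × Fin n => SS H a p.1 p.2 ∧ SS H b p.1 p.2),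
      (1 : ℝ) / cdg H p.1 p.2 ≤ 4 * t := by
  set G := Finset.univ.filter (fun p : Fin n × Fin n => SS H a p.1 p.2 ∧ SS H b p.1 p.2) with hG
  have hmem : ∀ p ∈ G, SS H a p.1 p.2 ∧ SS H b p.1 p.2 := by
    intro p hp; simpa [hG] using hp
  rcases aux_match G (fun p hp => (ne_of_card (h3 _ (hmem p hp).1.1)).2.2) t with
    ⟨x, y, hc, hm⟩ | ⟨C, hC, hcov⟩
  · exfalso
    apply hfree
    refine ⟨a, b, x, y, ?_, fun i => ⟨(hmem _ (hm i)).1.1, (hmem _ (hm i)).2.1⟩⟩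
    rw [Finset.union_assoc, Finset.card_union_of_disjoint, hc, Finset.card_pair hab]
    · omega
    · rw [Finset.disjoint_left]
      intro v hv hv2
      simp only [Finset.mem_insert, Finset.mem_singleton] at hv
      simp only [Finset.mem_union, Finset.mem_image, Finset.mem_univ, true_and] at hv2
      rcases hv2 with ⟨i, hi⟩ | ⟨i, hi⟩
      all_goals
        have e1 := ne_of_card (h3 _ (hmem _ (hm i)).1.1)
        have e2 := ne_of_card (h3 _ (hmem _ (hm i)).2.1)
        simp only at e1 e2
        rw [hi] at e1 e2
        rcases hv with rfl | rfl
        · simp at e1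
        · simp at e2
  · let D1 : Fin n → Finset (Fin n) := fun c => Finset.univ.filter (fun y => (c, y) ∈ G)
    let D2 : Fin n → Finset (Fin n) := fun c => Finset.univ.filter (fun y => (y, c) ∈ G)
    have key : ∑ p ∈ G, (1 : ℝ) / cdg H p.1 p.2 ≤
        ∑ c ∈ C, (∑ y ∈ D1 c, (1 : ℝ) / cdg H c y + ∑ y ∈ D2 c, (1 : ℝ) / cdg H c y) := by
      have hsub : G ⊆ (C ×ˢ Finset.univ).filter (· ∈ G) ∪ (Finset.univ ×ˢ C).filter (· ∈ G) := by
        intro p hp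
        have := hcov p hp
        simp [hp, this]
      calc ∑ p ∈ G, (1 : ℝ) / cdg H p.1 p.2
          ≤ ∑ p ∈ (C ×ˢ Finset.univ).filter (· ∈ G) ∪ (Finset.univ ×ˢ C).filter (· ∈ G),
            (1 : ℝ) / cdg H p.1 p.2 :=
            Finset.sum_le_sum_of_subset_of_nonneg hsub (fun _ _ _ => by positivity)
        _ ≤ ∑ p ∈ (C ×ˢ Finset.univ).filter (· ∈ G), (1 : ℝ) / cdg H p.1 p.2 +
            ∑ p ∈ (Finset.univ ×ˢ C).filter (· ∈ G), (1 : ℝ) / cdg H p.1 p.2 := by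
            rw [← Finset.sum_union_inter]
            have : 0 ≤ ∑ p ∈ (C ×ˢ Finset.univ).filter (· ∈ G) ∩
              (Finset.univ ×ˢ C).filter (· ∈ G), (1 : ℝ) / cdg H p.1 p.2 :=
              Finset.sum_nonneg (fun _ _ => by positivity)
            linarith
        _ = _ := by
            rw [Finset.sum_add_distrib]
            congr 1
            · rw [Finset.sum_filter, Finset.sum_product]
              apply Finset.sum_congr rfl
              intro c _
              rw [Finset.sum_filter]
            · rw [Finset.sum_filter, Finset.sum_product_right]
              apply Finset.sum_congr rfl
              intro c _
              rw [Finset.sum_filter]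
              apply Finset.sum_congr rfl
              intro y _
              rw [cdg_comm H c y]
    have k2 : ∀ c ∈ C, (∑ y ∈ D1 c, (1 : ℝ) / cdg H c y + ∑ y ∈ D2 c, (1 : ℝ) / cdg H c y) ≤ 2 := by
      intro c _
      have i1 := inner_le H a c (D1 c) (fun y hy => by
        have hy' : (c, y) ∈ G := by simpa [D1] using hy
        exact (hmem _ hy').1)
      have i2 := inner_le H a c (D2 c) (fun y hy => by
        have hy' : (y, c) ∈ G := by simpa [D2] using hy
        exact SS_comm _ _ _ _ (hmem _ hy').1)
      linarith
    have k3 := Finset.sum_le_sum k2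
    rw [Finset.sum_const, nsmul_eq_mul] at k3
    have : (C.card : ℝ) ≤ 2 * t := by exact_mod_cast hC
    linarith

theorem pointwise (d e : ℕ) (h : e ≤ d) :
    (e : ℝ) ≤ 1 + (d : ℝ) / 6 + 3 / 2 * (((e * e - e : ℕ) : ℝ) * (1 / d)) := by
  rcases Nat.eq_zero_or_pos e with rfl | he
  · simp; positivity
  have hd : (0 : ℝ) < d := by exact_mod_cast lt_of_lt_of_le he h
  have he' : (1 : ℝ) ≤ e := by exact_mod_cast he
  rw [Nat.cast_sub (Nat.le_mul_self e)]
  push_cast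
  have : 1 + (d : ℝ) / 6 + 3 / 2 * (((e : ℝ) * e - e) * (1 / d)) - e
      = (d ^ 2 - 6 * d * (e - 1) + 9 * (e * e - e)) / (6 * d) := by
    field_simp; ring
  have h2 : 0 ≤ ((d : ℝ) ^ 2 - 6 * d * (e - 1) + 9 * (e * e - e)) / (6 * d) := by
    apply div_nonneg _ (by positivity)
    nlinarith [sq_nonneg ((d : ℝ) - 3 * (e - 1))]
  linarith

/-- For every integer `t ≥ 2` and every positive integer `n`, every `K_{2,t}^{(3)}`-free
3-uniform hypergraph on `n` vertices has at most `(15 t log₂ t + 40 t) n²` edges,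
i.e. `ex(n, K_{2,t}^{(3)}) ≤ (15 t log₂ t + 40 t) n²`. -/
theorem ex_K2t3_upper (t n : ℕ) (ht : 2 ≤ t) (hn : 1 ≤ n)
    (H : Finset (Finset (Fin n))) (h3 : ∀ e ∈ H, e.card = 3)
    (hfree : ¬ hasK2t3 t H) :
    (H.card : ℝ) ≤ (15 * t * Real.logb 2 t + 40 * t) * n ^ 2 := by
  let E : Finset (Fin n × Fin n × Fin n) :=
    Finset.univ.filter (fun p => ({p.1, p.2.1, p.2.2} : Finset (Fin n)) ∈ H)
  let S : Finset (Fin n × Fin n × Fin n) :=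
    Finset.univ.filter (fun p => SS H p.1 p.2.1 p.2.2)
  let d' : Fin n → Fin n → Finset (Fin n) := fun x y => Finset.univ.filter (fun a => SS H a x y)
  have hHE : H.card ≤ E.card := by
    apply Finset.card_le_card_of_surjOn
      (fun p : Fin n × Fin n × Fin n => ({p.1, p.2.1, p.2.2} : Finset (Fin n)))
    intro e he
    obtain ⟨a, x, y, _, _, _, rfl⟩ := Finset.card_eq_three.1 (h3 e he)
    exact ⟨(a, x, y), by simpa [E] using he, rfl⟩
  have hES : E.card ≤ 3 * S.card := by
    have hsub : E ⊆ S ∪ S.image (fun p => (p.2.1, p.2.2, p.1)) ∪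
        S.image (fun p => (p.2.2, p.1, p.2.1)) := by
      rintro ⟨a, x, y⟩ hp
      have hp' : ({a, x, y} : Finset (Fin n)) ∈ H := by simpa [E] using hp
      have r1 : ({y, a, x} : Finset (Fin n)) ∈ H := by
        convert hp' using 1
        ext v; simp; tauto
      have r2 : ({x, y, a} : Finset (Fin n)) ∈ H := by
        convert hp' using 1
        ext v; simp; tauto
      have c1 := cdg_comm H y a
      have c2 := cdg_comm H y x
      have c3 := cdg_comm H x a
      have : SS H a x y ∨ SS H y a x ∨ SS H x y a := by
        unfold SS
        simp only [hp', r1, r2, true_and]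
        omega
      simp only [Finset.mem_union, Finset.mem_image, Prod.exists, Prod.mk.injEq]
      rcases this with h | h | h
      · left; left; simpa [S] using h
      · left; right; exact ⟨y, a, x, by simpa [S] using h, rfl, rfl, rfl⟩
      · right; exact ⟨x, y, a, by simpa [S] using h, rfl, rfl, rfl⟩
    have h1 := Finset.card_le_card hsub
    have h2 := Finset.card_union_le (S ∪ S.image (fun p => (p.2.1, p.2.2, p.1)))
      (S.image (fun p => (p.2.2, p.1, p.2.1)))
    have h4 := Finset.card_union_le S (S.image (fun p => (p.2.1, p.2.2, p.1)))
    have h5 : (S.image (fun p => (p.2.1, p.2.2, p.1))).card ≤ S.card := Finset.card_image_le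
    have h6 : (S.image (fun p => (p.2.2, p.1, p.2.1))).card ≤ S.card := Finset.card_image_le
    omega
  have hE : (E.card : ℝ) = ∑ p : Fin n × Fin n, (cdg H p.1 p.2 : ℝ) := by
    simp only [E, cdg, Finset.card_filter]
    push_cast
    rw [Fintype.sum_prod_type, Finset.sum_comm]
  have hS : (S.card : ℝ) = ∑ p : Fin n × Fin n, ((d' p.1 p.2).card : ℝ) := by
    simp only [S, d', Finset.card_filter]
    push_cast
    rw [Fintype.sum_prod_type, Finset.sum_comm]
  have hQ : ∑ p : Fin n × Fin n,
      ((((d' p.1 p.2).card * (d' p.1 p.2).card - (d' p.1 p.2).card : ℕ) : ℝ) *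
        (1 / cdg H p.1 p.2)) ≤ n ^ 2 * (4 * t) := by
    have e1 : ∀ p : Fin n × Fin n,
      ((((d' p.1 p.2).card * (d' p.1 p.2).card - (d' p.1 p.2).card : ℕ) : ℝ) *
        (1 / cdg H p.1 p.2)) = ∑ q : Fin n × Fin n,
          if (q.1 ≠ q.2 ∧ SS H q.1 p.1 p.2 ∧ SS H q.2 p.1 p.2) then (1 : ℝ) / cdg H p.1 p.2
          else 0 := by
      intro p
      rw [← Finset.offDiag_card, ← nsmul_eq_mul, ← Finset.sum_const, ← Finset.sum_filter]
      apply Finset.sum_congr _ (fun _ _ => rfl)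
      ext q
      simp [d', Finset.mem_offDiag]
      tauto
    rw [Finset.sum_congr rfl (fun p _ => e1 p), Finset.sum_comm]
    have e2 : ∀ q ∈ (Finset.univ : Finset (Fin n × Fin n)), (∑ p : Fin n × Fin n,
        if (q.1 ≠ q.2 ∧ SS H q.1 p.1 p.2 ∧ SS H q.2 p.1 p.2) then (1 : ℝ) / cdg H p.1 p.2
          else 0) ≤ 4 * t := by
      intro q _
      by_cases hq : q.1 = q.2
      · simp [hq]
      · have := pair_le H h3 hfree q.1 q.2 hq
        rw [Finset.sum_filter] at this
        simpa [hq] using this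
    have e3 := Finset.sum_le_sum e2
    rw [Finset.sum_const, nsmul_eq_mul] at e3
    refine e3.trans (le_of_eq ?_)
    rw [Finset.card_univ, Fintype.card_prod, Fintype.card_fin]
    push_cast
    ring
  have hmain : (S.card : ℝ) ≤ n ^ 2 + E.card / 6 + 3 / 2 * (n ^ 2 * (4 * t)) := by
    have hp : ∀ p ∈ (Finset.univ : Finset (Fin n × Fin n)), ((d' p.1 p.2).card : ℝ) ≤ _ :=
      fun p _ => pointwise (cdg H p.1 p.2) (d' p.1 p.2).card (by
        unfold cdg
        apply Finset.card_le_card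
        intro a ha
        simp only [d', Finset.mem_filter, Finset.mem_univ, true_and] at ha ⊢
        exact ha.1)
    have hs := Finset.sum_le_sum hp
    rw [← hS, Finset.sum_add_distrib, Finset.sum_add_distrib, ← Finset.mul_sum,
      ← Finset.sum_div, ← hE] at hs
    have hc : ∑ p : Fin n × Fin n, (1 : ℝ) = n ^ 2 := by simp; ring
    rw [hc] at hs
    linarith
  have hHE' : (H.card : ℝ) ≤ E.card := by exact_mod_cast hHE
  have hES' : (E.card : ℝ) ≤ 3 * S.card := by exact_mod_cast hES
  have ht' : (2 : ℝ) ≤ t := by exact_mod_cast ht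
  have hlog : 0 ≤ Real.logb 2 t := Real.logb_nonneg (by norm_num) (by linarith)
  have hl2 : 0 ≤ 15 * t * Real.logb 2 t * (n : ℝ) ^ 2 := by positivity
  have hn2 : (0 : ℝ) ≤ (n : ℝ) ^ 2 := by positivity
  nlinarith
end

section
/- Let t ≥ 2 be an integer and let H be a 3-partite 3-uniform hypergraph with parts A, B, C, each of size n, such that every edge of H meets each of A, B, C in exactly one vertex. If H contains no copy of K_{2,t}^{(3)}, then the number of edges of H is at most (30·t·log t + 80·t)·n², where log denotes the base-2 logarithm. -/
lemma aux_match_s1 {V : Type*} [DecidableEq V] (B C : Finset V) (G : V → V → Prop) (k : ℕ) :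
    (∃ x y : Fin k → V, Function.Injective x ∧ Function.Injective y ∧
      ∀ i, x i ∈ B ∧ y i ∈ C ∧ G (x i) (y i)) ∨
    (∃ S R : Finset V, S.card ≤ k ∧ R.card ≤ k ∧
      ∀ x ∈ B, ∀ y ∈ C, G x y → x ∈ S ∨ y ∈ R) := by
  induction k with
  | zero =>
    left
    exact ⟨Fin.elim0, Fin.elim0, fun i => i.elim0, fun i => i.elim0, fun i => i.elim0⟩
  | succ k ih =>
    rcases ih with ⟨x, y, hx, hy, h⟩ | ⟨S, R, hS, hR, h⟩
    · by_cases hc : ∀ u ∈ B, ∀ v ∈ C, G u v →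
          u ∈ Finset.image x Finset.univ ∨ v ∈ Finset.image y Finset.univ
      · right
        refine ⟨_, _, ?_, ?_, hc⟩
        · exact (Finset.card_image_le).trans (by simp)
        · exact (Finset.card_image_le).trans (by simp)
      · left
        push Not at hc
        obtain ⟨u, hu, v, hv, hG, h1, h2⟩ := hc
        refine ⟨Fin.cons u x, Fin.cons v y, ?_, ?_, ?_⟩
        · rw [Fin.cons_injective_iff]
          exact ⟨by simpa using h1, hx⟩
        · rw [Fin.cons_injective_iff]
          exact ⟨by simpa using h2, hy⟩
        · intro i
          refine Fin.cases ?_ ?_ i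
          · simpa using ⟨hu, hv, hG⟩
          · intro j
            simpa using h j
    · right
      exact ⟨S, R, by omega, by omega, h⟩

lemma aux_real (s d : ℝ) (hs : 0 ≤ s) (hsd : s ≤ d) :
    2 / 3 * s ≤ d / 9 + s * s * d⁻¹ := by
  rcases (hs.trans hsd).eq_or_lt with h | h
  · have : s = 0 := by linarith
    subst this
    simp [← h]
  · have h2 : s * s * d⁻¹ = s * s / d := by rw [div_eq_mul_inv]
    rw [h2, ← sub_nonneg]
    have : d / 9 + s * s / d - 2 / 3 * s = (s - d / 3) ^ 2 / d := by
      field_simp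
      ring
    rw [this]
    positivity

open Classical in
lemma aux_core {V : Type*} (t n : ℕ) (A B C : Finset V)
    (hA : A.card = n) (hB : B.card = n) (hC : C.card = n)
    (T : V → V → V → Prop)
    (hcov : ∀ a ∈ A, ∀ b ∈ A, a ≠ b → ∃ S R : Finset V, S.card ≤ t ∧ R.card ≤ t ∧
      ∀ x ∈ B, ∀ y ∈ C, T a x y ∧ T b x y → x ∈ S ∨ y ∈ R)
    (p q r : V → V → ℝ)
    (hp : ∀ x y, p x y = ∑ a ∈ A, if T a x y then (1 : ℝ) else 0)
    (hq : ∀ a y, q a y = ∑ x ∈ B, if T a x y then (1 : ℝ) else 0)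
    (hr : ∀ a x, r a x = ∑ y ∈ C, if T a x y then (1 : ℝ) else 0) :
    2 / 3 * (∑ a ∈ A, ∑ x ∈ B, ∑ y ∈ C,
        if T a x y ∧ q a y ≤ p x y ∧ r a x ≤ p x y then (1 : ℝ) else 0) ≤
      (∑ a ∈ A, ∑ x ∈ B, ∑ y ∈ C, if T a x y then (1 : ℝ) else 0) / 9
        + (2 * t + 1) * (n : ℝ) ^ 2 := by
  set I : V → V → V → ℝ := fun a x y =>
    if T a x y ∧ q a y ≤ p x y ∧ r a x ≤ p x y then (1 : ℝ) else 0 with hI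
  set J : V → V → V → ℝ := fun a x y => if T a x y then (1 : ℝ) else 0 with hJ
  have hI0 : ∀ a x y, 0 ≤ I a x y := by
    intro a x y; simp only [hI]; split_ifs <;> norm_num
  have hI1 : ∀ a x y, I a x y ≤ 1 := by
    intro a x y; simp only [hI]; split_ifs <;> norm_num
  have hJ0 : ∀ a x y, 0 ≤ J a x y := by
    intro a x y; simp only [hJ]; split_ifs <;> norm_num
  have hIJ : ∀ a x y, I a x y ≤ J a x y := by
    intro a x y; simp only [hI, hJ]; split_ifs <;> first | (exfalso; tauto) | norm_num
  have hp0 : ∀ x y, 0 ≤ p x y := fun x y => by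
    rw [hp]; exact Finset.sum_nonneg fun a _ => hJ0 a x y
  have hw0 : ∀ x y, 0 ≤ (p x y)⁻¹ := fun x y => inv_nonneg.2 (hp0 x y)
  -- positivity of degrees
  have hq1 : ∀ a y, ∀ x ∈ B, T a x y → 0 < q a y := fun a y x hx h => by
    rw [hq]
    refine Finset.sum_pos' (fun z _ => hJ0 a z y) ⟨x, hx, by simp [h]⟩
  have hr1 : ∀ a x, ∀ y ∈ C, T a x y → 0 < r a x := fun a x y hy h => by
    rw [hr]
    refine Finset.sum_pos' (fun z _ => hJ0 a x z) ⟨y, hy, by simp [h]⟩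
  have hrow : ∀ a x, ∑ y ∈ C, I a x y * (p x y)⁻¹ ≤ 1 := by
    intro a x
    calc ∑ y ∈ C, I a x y * (p x y)⁻¹ ≤ ∑ y ∈ C, J a x y * (r a x)⁻¹ := by
          refine Finset.sum_le_sum fun y hy => ?_
          by_cases h : T a x y ∧ q a y ≤ p x y ∧ r a x ≤ p x y
          · have := inv_anti₀ (hr1 a x y hy h.1) h.2.2
            simpa [hI, hJ, h, h.1] using this
          · have h1 : I a x y = 0 := by simp only [hI]; rw [if_neg h]
            rw [h1, zero_mul]
            refine mul_nonneg (hJ0 _ _ _) (inv_nonneg.2 ?_)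
            rw [hr]; exact Finset.sum_nonneg fun z _ => hJ0 a x z
      _ = r a x * (r a x)⁻¹ := by rw [← Finset.sum_mul, hr]
      _ ≤ 1 := mul_inv_le_one
  have hcol : ∀ a y, ∑ x ∈ B, I a x y * (p x y)⁻¹ ≤ 1 := by
    intro a y
    calc ∑ x ∈ B, I a x y * (p x y)⁻¹ ≤ ∑ x ∈ B, J a x y * (q a y)⁻¹ := by
          refine Finset.sum_le_sum fun x hx => ?_
          by_cases h : T a x y ∧ q a y ≤ p x y ∧ r a x ≤ p x y
          · have := inv_anti₀ (hq1 a y x hx h.1) h.2.1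
            simpa [hI, hJ, h, h.1] using this
          · have h1 : I a x y = 0 := by simp only [hI]; rw [if_neg h]
            rw [h1, zero_mul]
            refine mul_nonneg (hJ0 _ _ _) (inv_nonneg.2 ?_)
            rw [hq]; exact Finset.sum_nonneg fun z _ => hJ0 a z y
      _ = q a y * (q a y)⁻¹ := by rw [← Finset.sum_mul, hq]
      _ ≤ 1 := mul_inv_le_one
  set F : V → V → ℝ := fun a b => ∑ x ∈ B, ∑ y ∈ C, I a x y * I b x y * (p x y)⁻¹ with hF
  have hF0 : ∀ a b, 0 ≤ F a b := fun a b =>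
    Finset.sum_nonneg fun x _ => Finset.sum_nonneg fun y _ =>
      mul_nonneg (mul_nonneg (hI0 _ _ _) (hI0 _ _ _)) (hw0 _ _)
  have hoff : ∀ a ∈ A, ∀ b ∈ A, a ≠ b → F a b ≤ 2 * t := by
    intro a ha b hb hab
    obtain ⟨S, R, hS, hR, hSR⟩ := hcov a ha b hb hab
    have hg0 : ∀ x y, 0 ≤ I a x y * (p x y)⁻¹ := fun x y => mul_nonneg (hI0 _ _ _) (hw0 _ _)
    have h1 : F a b ≤ ∑ x ∈ B, ∑ y ∈ C, ((if x ∈ S then I a x y * (p x y)⁻¹ else 0)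
        + (if y ∈ R then I a x y * (p x y)⁻¹ else 0)) := by
      refine Finset.sum_le_sum fun x hx => Finset.sum_le_sum fun y hy => ?_
      have hle : I a x y * I b x y * (p x y)⁻¹ ≤ I a x y * (p x y)⁻¹ := by
        refine mul_le_mul_of_nonneg_right ?_ (hw0 _ _)
        exact mul_le_of_le_one_right (hI0 _ _ _) (hI1 _ _ _)
      by_cases h : T a x y ∧ T b x y
      · have := hg0 x y
        rcases hSR x hx y hy h with h | h
        · rw [if_pos h]; split_ifs <;> linarith
        · rw [if_pos h]; split_ifs <;> linarith
      · have h0 : I a x y * I b x y = 0 := by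
          by_cases h2 : T a x y
          · have h3 : ¬ T b x y := fun h3 => h ⟨h2, h3⟩
            simp [hI, h3]
          · simp [hI, h2]
        rw [h0, zero_mul]
        have := hg0 x y
        split_ifs <;> linarith
    have h2 : ∑ x ∈ B, ∑ y ∈ C, (if x ∈ S then I a x y * (p x y)⁻¹ else 0) ≤ t := by
      calc _ ≤ ∑ x ∈ B, (if x ∈ S then (1 : ℝ) else 0) := by
            refine Finset.sum_le_sum fun x _ => ?_
            split_ifs
            · exact hrow a x
            · simp
        _ = ((B.filter (· ∈ S)).card : ℝ) := by rw [Finset.card_filter]; push_cast; rfl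
        _ ≤ t := by
            have : (B.filter (· ∈ S)).card ≤ S.card :=
              Finset.card_le_card fun z hz => (Finset.mem_filter.1 hz).2
            exact_mod_cast this.trans hS
    have h3 : ∑ x ∈ B, ∑ y ∈ C, (if y ∈ R then I a x y * (p x y)⁻¹ else 0) ≤ t := by
      rw [Finset.sum_comm]
      calc _ ≤ ∑ y ∈ C, (if y ∈ R then (1 : ℝ) else 0) := by
            refine Finset.sum_le_sum fun y _ => ?_
            split_ifs
            · exact hcol a y
            · simp
        _ = ((C.filter (· ∈ R)).card : ℝ) := by rw [Finset.card_filter]; push_cast; rfl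
        _ ≤ t := by
            have : (C.filter (· ∈ R)).card ≤ R.card :=
              Finset.card_le_card fun z hz => (Finset.mem_filter.1 hz).2
            exact_mod_cast this.trans hR
    simp only [Finset.sum_add_distrib] at h1
    linarith
  have hdiag : ∑ a ∈ A, F a a ≤ (n : ℝ) ^ 2 := by
    have h1 : ∑ a ∈ A, F a a ≤ ∑ a ∈ A, ∑ x ∈ B, ∑ y ∈ C, J a x y * (p x y)⁻¹ := by
      refine Finset.sum_le_sum fun a _ => Finset.sum_le_sum fun x _ =>
        Finset.sum_le_sum fun y _ => ?_
      refine mul_le_mul_of_nonneg_right ?_ (hw0 _ _)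
      exact (mul_le_of_le_one_right (hI0 _ _ _) (hI1 _ _ _)).trans (hIJ _ _ _)
    refine h1.trans ?_
    rw [Finset.sum_comm]
    calc _ ≤ ∑ x ∈ B, ∑ y ∈ C, (1 : ℝ) := by
          refine Finset.sum_le_sum fun x _ => ?_
          rw [Finset.sum_comm]
          refine Finset.sum_le_sum fun y _ => ?_
          rw [← Finset.sum_mul, ← hp]
          exact mul_inv_le_one
      _ = (n : ℝ) ^ 2 := by simp [hB, hC, sq]
  have htot : ∑ a ∈ A, ∑ b ∈ A, F a b ≤ (2 * t + 1) * (n : ℝ) ^ 2 := by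
    calc ∑ a ∈ A, ∑ b ∈ A, F a b
        ≤ ∑ a ∈ A, ∑ b ∈ A, ((2 * t : ℝ) + if a = b then F a a else 0) := by
          refine Finset.sum_le_sum fun a ha => Finset.sum_le_sum fun b hb => ?_
          split_ifs with h
          · subst h
            have : (0 : ℝ) ≤ 2 * t := by positivity
            linarith
          · rw [add_zero]; exact hoff a ha b hb h
      _ = (n : ℝ) * (n * (2 * t)) + ∑ a ∈ A, F a a := by
          simp only [Finset.sum_add_distrib]
          congr 1
          · simp [hA]
          · refine Finset.sum_congr rfl fun a ha => ?_
            simp [ha]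
      _ ≤ _ := by nlinarith [hdiag]
  have hswap : ∀ K : V → V → V → ℝ, ∑ a ∈ A, ∑ x ∈ B, ∑ y ∈ C, K a x y
      = ∑ x ∈ B, ∑ y ∈ C, ∑ a ∈ A, K a x y := by
    intro K
    rw [Finset.sum_comm]
    exact Finset.sum_congr rfl fun x _ => Finset.sum_comm
  have hFF : ∑ a ∈ A, ∑ b ∈ A, F a b = ∑ x ∈ B, ∑ y ∈ C,
      (∑ a ∈ A, I a x y) * (∑ a ∈ A, I a x y) * (p x y)⁻¹ := by
    have h1 : ∀ a ∈ A, ∑ b ∈ A, F a b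
        = ∑ x ∈ B, ∑ y ∈ C, ∑ b ∈ A, I a x y * I b x y * (p x y)⁻¹ := by
      intro a _
      rw [← hswap (fun b x y => I a x y * I b x y * (p x y)⁻¹)]
    rw [Finset.sum_congr rfl h1, hswap]
    refine Finset.sum_congr rfl fun x _ => Finset.sum_congr rfl fun y _ => ?_
    rw [Finset.sum_mul_sum, Finset.sum_mul]
    exact Finset.sum_congr rfl fun a _ => by rw [Finset.sum_mul]
  refine le_trans ?_ (add_le_add_right htot _)
  rw [hFF, hswap I, hswap J, Finset.mul_sum, Finset.sum_div, ← Finset.sum_add_distrib]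
  refine Finset.sum_le_sum fun x _ => ?_
  rw [Finset.mul_sum, Finset.sum_div, ← Finset.sum_add_distrib]
  refine Finset.sum_le_sum fun y _ => ?_
  have h1 : ∑ a ∈ A, J a x y = p x y := (hp x y).symm
  rw [h1]
  refine aux_real _ _ (Finset.sum_nonneg fun a _ => hI0 _ _ _) ?_
  rw [← h1]
  exact Finset.sum_le_sum fun a _ => hIJ _ _ _

lemma aux_cover {V : Type*} [DecidableEq V] (t : ℕ) (A B C : Finset V)
    (hAB : Disjoint A B) (hAC : Disjoint A C) (hBC : Disjoint B C)
    (H : Finset (Finset V)) (hfree : ¬ hasK2t3 t H) :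
    ∀ a ∈ A, ∀ b ∈ A, a ≠ b → ∃ S R : Finset V, S.card ≤ t ∧ R.card ≤ t ∧
      ∀ x ∈ B, ∀ y ∈ C, ({a, x, y} : Finset V) ∈ H ∧ ({b, x, y} : Finset V) ∈ H →
        x ∈ S ∨ y ∈ R := by
  intro a ha b hb hab
  rcases aux_match_s1 B C (fun x y => ({a, x, y} : Finset V) ∈ H ∧ ({b, x, y} : Finset V) ∈ H) t
    with ⟨x, y, hx, hy, h⟩ | h
  · exfalso
    refine hfree ⟨a, b, x, y, ?_, fun i => (h i).2.2⟩
    have hX : Finset.image x Finset.univ ⊆ B := by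
      intro z hz
      obtain ⟨i, _, rfl⟩ := Finset.mem_image.1 hz
      exact (h i).1
    have hY : Finset.image y Finset.univ ⊆ C := by
      intro z hz
      obtain ⟨i, _, rfl⟩ := Finset.mem_image.1 hz
      exact (h i).2.1
    have hab' : ({a, b} : Finset V) ⊆ A := by
      intro z hz
      simp only [Finset.mem_insert, Finset.mem_singleton] at hz
      rcases hz with rfl | rfl <;> assumption
    rw [Finset.card_union_of_disjoint, Finset.card_union_of_disjoint,
      Finset.card_image_of_injective _ hx, Finset.card_image_of_injective _ hy,
      Finset.card_pair hab]
    · simp; ring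
    · exact Finset.disjoint_of_subset_left hab' (Finset.disjoint_of_subset_right hX hAB)
    · rw [Finset.disjoint_union_left]
      exact ⟨Finset.disjoint_of_subset_left hab' (Finset.disjoint_of_subset_right hY hAC),
        Finset.disjoint_of_subset_left hX (Finset.disjoint_of_subset_right hY hBC)⟩
  · exact h

lemma aux_count {V : Type*} [DecidableEq V] (A B C : Finset V) (H : Finset (Finset V))
    (hpart : ∀ e ∈ H, e ⊆ A ∪ B ∪ C ∧
      (e ∩ A).card = 1 ∧ (e ∩ B).card = 1 ∧ (e ∩ C).card = 1) :
    (H.card : ℝ) ≤ ∑ a ∈ A, ∑ x ∈ B, ∑ y ∈ C,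
      if ({a, x, y} : Finset V) ∈ H then (1 : ℝ) else 0 := by
  have hsub : H ⊆ ((A ×ˢ B ×ˢ C).filter (fun z => ({z.1, z.2.1, z.2.2} : Finset V) ∈ H)).image
      (fun z => ({z.1, z.2.1, z.2.2} : Finset V)) := by
    intro e he
    obtain ⟨h0, h1, h2, h3⟩ := hpart e he
    obtain ⟨a, ha⟩ := Finset.card_eq_one.1 h1
    obtain ⟨x, hx⟩ := Finset.card_eq_one.1 h2
    obtain ⟨y, hy⟩ := Finset.card_eq_one.1 h3
    have heq : ({a, x, y} : Finset V) = e := by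
      have : e = (e ∩ A) ∪ ((e ∩ B) ∪ (e ∩ C)) := by
        rw [← Finset.inter_union_distrib_left, ← Finset.inter_union_distrib_left,
          ← Finset.union_assoc]
        exact (Finset.inter_eq_left.2 h0).symm
      rw [this, ha, hx, hy]
      rfl
    have ha' : a ∈ A := (Finset.mem_inter.1 (ha ▸ Finset.mem_singleton_self a)).2
    have hx' : x ∈ B := (Finset.mem_inter.1 (hx ▸ Finset.mem_singleton_self x)).2
    have hy' : y ∈ C := (Finset.mem_inter.1 (hy ▸ Finset.mem_singleton_self y)).2
    refine Finset.mem_image.2 ⟨(a, x, y), ?_, heq⟩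
    simp [ha', hx', hy', heq, he]
  have h1 := (Finset.card_le_card hsub).trans Finset.card_image_le
  have h2 : (H.card : ℝ) ≤ (((A ×ˢ B ×ˢ C).filter
      (fun z => ({z.1, z.2.1, z.2.2} : Finset V) ∈ H)).card : ℝ) := by exact_mod_cast h1
  refine h2.trans (le_of_eq ?_)
  rw [Finset.card_filter]
  push_cast
  rw [Finset.sum_product]
  refine Finset.sum_congr rfl fun a _ => ?_
  rw [Finset.sum_product]

/-- Let `t ≥ 2` and let `H` be a 3-partite 3-uniform hypergraph with pairwise disjoint
parts `A`, `B`, `C`, each of size `n`, every edge meeting each part in exactly one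
vertex. If `H` is `K_{2,t}^{(3)}`-free, then `|H| ≤ (30 t log₂ t + 80 t) n²`. -/
theorem tripartite_K2t3_free_upper {V : Type*} [DecidableEq V] (t n : ℕ) (ht : 2 ≤ t)
    (A B C : Finset V)
    (hAB : Disjoint A B) (hAC : Disjoint A C) (hBC : Disjoint B C)
    (hA : A.card = n) (hB : B.card = n) (hC : C.card = n)
    (H : Finset (Finset V))
    (hpart : ∀ e ∈ H, e ⊆ A ∪ B ∪ C ∧
      (e ∩ A).card = 1 ∧ (e ∩ B).card = 1 ∧ (e ∩ C).card = 1)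
    (hfree : ¬ hasK2t3 t H) :
    (H.card : ℝ) ≤ (30 * t * Real.logb 2 t + 80 * t) * n ^ 2 := by
  classical
  obtain ⟨T, hT⟩ : ∃ T : V → V → V → Prop, ∀ a x y, T a x y ↔ ({a, x, y} : Finset V) ∈ H :=
    ⟨_, fun _ _ _ => Iff.rfl⟩
  have hc : (H.card : ℝ) ≤ ∑ a ∈ A, ∑ x ∈ B, ∑ y ∈ C, if T a x y then (1 : ℝ) else 0 := by
    refine (aux_count A B C H hpart).trans_eq ?_
    refine Finset.sum_congr rfl fun a _ => Finset.sum_congr rfl fun x _ =>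
      Finset.sum_congr rfl fun y _ => ?_
    simp only [hT]
  have s1 : ∀ a x y : V, ({x, a, y} : Finset V) = {a, x, y} := fun a x y =>
    Finset.insert_comm _ _ _
  have s2 : ∀ a x y : V, ({y, a, x} : Finset V) = {a, x, y} := fun a x y => by
    rw [Finset.insert_comm, Finset.pair_comm]
  set p : V → V → ℝ := fun x y => ∑ a ∈ A, if T a x y then (1 : ℝ) else 0 with hp
  set q : V → V → ℝ := fun a y => ∑ x ∈ B, if T a x y then (1 : ℝ) else 0 with hq
  set r : V → V → ℝ := fun a x => ∑ y ∈ C, if T a x y then (1 : ℝ) else 0 with hr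
  have k1 := aux_core t n A B C hA hB hC T
    (by simpa only [hT] using aux_cover t A B C hAB hAC hBC H hfree) p q r
    (fun _ _ => rfl) (fun _ _ => rfl) (fun _ _ => rfl)
  have k2 := aux_core t n B A C hB hA hC (fun x a y => T a x y)
    (by simpa only [s1, hT] using aux_cover t B A C hAB.symm hBC hAC H hfree)
    q p (fun x a => r a x)
    (fun _ _ => rfl) (fun _ _ => rfl) (fun _ _ => rfl)
  have k3 := aux_core t n C A B hC hA hB (fun y a x => T a x y)
    (by simpa only [s2, hT] using aux_cover t C A B hAC.symm hBC.symm hAB H hfree)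
    r (fun y x => p x y) (fun y a => q a y)
    (fun _ _ => rfl) (fun _ _ => rfl) (fun _ _ => rfl)
  have hsw2 : ∀ K : V → V → V → ℝ, ∑ x ∈ B, ∑ a ∈ A, ∑ y ∈ C, K a x y
      = ∑ a ∈ A, ∑ x ∈ B, ∑ y ∈ C, K a x y := fun K => Finset.sum_comm
  have hsw3 : ∀ K : V → V → V → ℝ, ∑ y ∈ C, ∑ a ∈ A, ∑ x ∈ B, K a x y
      = ∑ a ∈ A, ∑ x ∈ B, ∑ y ∈ C, K a x y := fun K => by
    rw [Finset.sum_comm]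
    exact Finset.sum_congr rfl fun a _ => Finset.sum_comm
  rw [hsw2 (fun a x y => if T a x y ∧ p x y ≤ q a y ∧ r a x ≤ q a y then (1 : ℝ) else 0),
    hsw2 (fun a x y => if T a x y then (1 : ℝ) else 0)] at k2
  rw [hsw3 (fun a x y => if T a x y ∧ p x y ≤ r a x ∧ q a y ≤ r a x then (1 : ℝ) else 0),
    hsw3 (fun a x y => if T a x y then (1 : ℝ) else 0)] at k3
  have hsum : (∑ a ∈ A, ∑ x ∈ B, ∑ y ∈ C, if T a x y then (1 : ℝ) else 0) ≤
      (∑ a ∈ A, ∑ x ∈ B, ∑ y ∈ C,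
        if T a x y ∧ q a y ≤ p x y ∧ r a x ≤ p x y then (1 : ℝ) else 0)
      + (∑ a ∈ A, ∑ x ∈ B, ∑ y ∈ C,
        if T a x y ∧ p x y ≤ q a y ∧ r a x ≤ q a y then (1 : ℝ) else 0)
      + (∑ a ∈ A, ∑ x ∈ B, ∑ y ∈ C,
        if T a x y ∧ p x y ≤ r a x ∧ q a y ≤ r a x then (1 : ℝ) else 0) := by
    simp only [← Finset.sum_add_distrib]
    refine Finset.sum_le_sum fun a _ => Finset.sum_le_sum fun x _ =>
      Finset.sum_le_sum fun y _ => ?_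
    by_cases h : T a x y
    · simp only [h, true_and, if_true]
      generalize p x y = u
      generalize q a y = v
      generalize r a x = w
      have : (v ≤ u ∧ w ≤ u) ∨ (u ≤ v ∧ w ≤ v) ∨ (u ≤ w ∧ v ≤ w) := by
        rcases le_total u v with h1 | h1 <;> rcases le_total v w with h2 | h2 <;>
          rcases le_total u w with h3 | h3 <;>
          first | tauto | exact Or.inl ⟨by linarith, by linarith⟩
      split_ifs <;> first | (exfalso; tauto) | norm_num
    · simp [h]
  have hE : (H.card : ℝ) ≤ 9 * (2 * t + 1) * (n : ℝ) ^ 2 := by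
    refine hc.trans ?_
    linarith
  refine hE.trans (mul_le_mul_of_nonneg_right ?_ (by positivity))
  have ht' : (2 : ℝ) ≤ t := by exact_mod_cast ht
  have hlog : 0 ≤ Real.logb 2 (t : ℝ) := Real.logb_nonneg (by norm_num) (by linarith)
  have : 0 ≤ 30 * (t : ℝ) * Real.logb 2 t := by positivity
  linarith
end

section
/- For every integer t ≥ 2, the limit superior as n → ∞ of ex(n, K_{2,t}^{(3)}) / binom(n, 2) is at most 30·t·log t + 80·t, where log denotes the base-2 logarithm. -/
/-- `ex(n, K_{2,t}^{(3)})`: the maximum number of edges of a 3-uniform hypergraph on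
`n` vertices containing no copy of `K_{2,t}^{(3)}`. -/
noncomputable def exK2t3 (t n : ℕ) : ℕ :=
  sSup {m | ∃ H : Finset (Finset (Fin n)),
    (∀ e ∈ H, e.card = 3) ∧ ¬ hasK2t3 t H ∧ H.card = m}


namespace K2t

open Finset

variable {V : Type*} [Fintype V] [DecidableEq V]

lemma matching_or_cover (G : V → V → Prop) (hirr : ∀ x, ¬ G x x) (k : ℕ) :
    (∃ x y : Fin k → V, (image x univ ∪ image y univ).card = 2 * k ∧ ∀ i, G (x i) (y i)) ∨
    (∃ C : Finset V, C.card ≤ 2 * k ∧ ∀ x y, G x y → x ∈ C ∨ y ∈ C) := by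
  induction k with
  | zero => exact Or.inl ⟨Fin.elim0, Fin.elim0, by simp, fun i => i.elim0⟩
  | succ k ih =>
    rcases ih with ⟨x, y, hc, hG⟩ | ⟨C, hC, hcov⟩
    · by_cases h : ∀ u v, G u v → u ∈ (image x univ ∪ image y univ) ∨ v ∈ (image x univ ∪ image y univ)
      · exact Or.inr ⟨_, by omega, h⟩
      · push Not at h
        obtain ⟨u, v, huv, hu, hv⟩ := h
        left
        have hne : u ≠ v := by rintro rfl; exact hirr _ huv
        refine ⟨Fin.cons u x, Fin.cons v y, ?_, ?_⟩
        · have : image (Fin.cons u x : Fin (k+1) → V) univ ∪ image (Fin.cons v y : Fin (k+1) → V) univ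
              = insert u (insert v (image x univ ∪ image y univ)) := by
            ext z
            simp only [mem_union, mem_image, mem_univ, true_and, mem_insert, Fin.exists_fin_succ,
              Fin.cons_zero, Fin.cons_succ]
            grind
          rw [this, card_insert_of_notMem, card_insert_of_notMem hv, hc]
          · ring
          · simp only [mem_insert, not_or]; exact ⟨hne, hu⟩
        · intro i
          refine Fin.cases ?_ (fun j => ?_) i
          · simpa using huv
          · simpa using hG j
    · exact Or.inr ⟨C, by omega, hcov⟩

/-- codegree -/
def D (H : Finset (Finset V)) (x y : V) : ℕ := (univ.filter fun a => ({a, x, y} : Finset V) ∈ H).card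

noncomputable def w (H : Finset (Finset V)) (a x y : V) : ℝ := (max (D H a x : ℝ) (D H a y))⁻¹

lemma w_nonneg (H : Finset (Finset V)) (a x y : V) : 0 ≤ w H a x y := by
  unfold w; positivity

lemma rot (a x y : V) : ({a, x, y} : Finset V) = {x, y, a} := by
  ext z; simp only [mem_insert, mem_singleton]; tauto

lemma swp (a x y : V) : ({a, x, y} : Finset V) = {a, y, x} := by
  ext z; simp only [mem_insert, mem_singleton]; tauto

lemma D_symm (H : Finset (Finset V)) (x y : V) : D H x y = D H y x := by
  unfold D; congr 1; ext a; rw [mem_filter, mem_filter, swp]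

lemma D_pos (H : Finset (Finset V)) {a x y : V} (h : ({a, x, y} : Finset V) ∈ H) : 1 ≤ D H x y := by
  unfold D; exact card_pos.2 ⟨a, by simpa using h⟩

lemma D_eq (H : Finset (Finset V)) (a x : V) :
    (univ.filter fun y => ({a, x, y} : Finset V) ∈ H).card = D H a x := by
  unfold D; congr 1; ext y; rw [mem_filter, mem_filter, rot y a x]

lemma ne_of_mem {H : Finset (Finset V)} (h3 : ∀ e ∈ H, e.card = 3) {a x y : V}
    (h : ({a, x, y} : Finset V) ∈ H) : a ≠ x ∧ a ≠ y ∧ x ≠ y := by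
  have := h3 _ h
  exact (card_eq_three_iff_of_insert this)
where
  card_eq_three_iff_of_insert {a x y : V} (h : ({a, x, y} : Finset V).card = 3) :
      a ≠ x ∧ a ≠ y ∧ x ≠ y := by
    have h2 := card_le_two (a := a) (b := y)
    have h4 := card_le_two (a := a) (b := x)
    have h5 := card_le_two (a := x) (b := y)
    refine ⟨?_, ?_, ?_⟩ <;> rintro rfl <;> simp at h <;> omega

lemma sum_row (H : Finset (Finset V)) (a x : V) :
    ∑ y, (if ({a, x, y} : Finset V) ∈ H then (D H a x : ℝ)⁻¹ else 0) ≤ 1 := by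
  rw [← sum_filter, sum_const, D_eq, nsmul_eq_mul]
  exact mul_inv_le_one

lemma upper {H : Finset (Finset V)} (h3 : ∀ e ∈ H, e.card = 3) {t : ℕ} (hf : ¬ hasK2t3 t H)
    {a b : V} (hab : a ≠ b) :
    ∑ x, ∑ y, (if ({a, x, y} : Finset V) ∈ H ∧ ({b, x, y} : Finset V) ∈ H then w H a x y else 0)
      ≤ 4 * t := by
  obtain ⟨x, y, hc, hG⟩ | ⟨C, hC, hcov⟩ := matching_or_cover
    (fun x y => ({a, x, y} : Finset V) ∈ H ∧ ({b, x, y} : Finset V) ∈ H)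
    (fun x h => (ne_of_mem h3 h.1).2.2 rfl) t
  · exfalso
    refine hf ⟨a, b, x, y, ?_, hG⟩
    rw [union_assoc, card_union_of_disjoint, hc, card_pair hab]
    · ring
    · rw [disjoint_left]
      intro z hz hz'
      simp only [mem_insert, mem_singleton, mem_union, mem_image, mem_univ, true_and] at hz hz'
      have h1 := fun i => ne_of_mem h3 (hG i).1
      have h2 := fun i => ne_of_mem h3 (hG i).2
      grind
  · have key : ∀ x y, (if ({a, x, y} : Finset V) ∈ H ∧ ({b, x, y} : Finset V) ∈ H then w H a x y else 0)
        ≤ (if x ∈ C then (if ({a, x, y} : Finset V) ∈ H then (D H a x : ℝ)⁻¹ else 0) else 0)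
        + (if y ∈ C then (if ({a, y, x} : Finset V) ∈ H then (D H a y : ℝ)⁻¹ else 0) else 0) := by
      intro x y
      split_ifs with h
      all_goals try positivity
      all_goals try (exfalso; grind [swp a x y])
      all_goals
        have hx : w H a x y ≤ (D H a x : ℝ)⁻¹ := by
          have : 1 ≤ D H a x := D_pos H (by rw [rot]; exact h.1)
          have : (1:ℝ) ≤ D H a x := by exact_mod_cast this
          exact inv_anti₀ (by linarith) (le_max_left _ _)
        have hy : w H a x y ≤ (D H a y : ℝ)⁻¹ := by
          have : 1 ≤ D H a y := D_pos H (by rw [rot, swp]; exact h.1)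
          have : (1:ℝ) ≤ D H a y := by exact_mod_cast this
          exact inv_anti₀ (by linarith) (le_max_right _ _)
        have h0 : 0 ≤ (D H a x : ℝ)⁻¹ := by positivity
        have h0' : 0 ≤ (D H a y : ℝ)⁻¹ := by positivity
        linarith
    have aux : ∑ x, ∑ y, (if x ∈ C then (if ({a, x, y} : Finset V) ∈ H then (D H a x : ℝ)⁻¹ else 0) else 0)
        ≤ C.card := by
      calc _ ≤ ∑ x, (if x ∈ C then (1:ℝ) else 0) := by
            refine sum_le_sum fun x _ => ?_
            split_ifs
            · exact sum_row H a x
            · simp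
        _ = C.card := by simp
    have hC' : (C.card : ℝ) ≤ 2 * t := by exact_mod_cast hC
    calc _ ≤ _ := sum_le_sum fun x _ => sum_le_sum fun y _ => key x y
      _ = _ := by simp only [sum_add_distrib]; rfl
      _ ≤ (C.card : ℝ) + C.card := by
        refine add_le_add aux ?_
        rw [sum_comm]; exact aux
      _ ≤ _ := by linarith

lemma upper_sum {H : Finset (Finset V)} (h3 : ∀ e ∈ H, e.card = 3) {t : ℕ} (hf : ¬ hasK2t3 t H) :
    ∑ a, ∑ x, ∑ y, (if ({a, x, y} : Finset V) ∈ H then ((D H x y : ℝ) - 1) * w H a x y else 0)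
      ≤ 4 * t * (Fintype.card V * (Fintype.card V - 1)) := by
  have h1 : ∀ a x y, (if ({a, x, y} : Finset V) ∈ H then ((D H x y : ℝ) - 1) * w H a x y else 0)
      = ∑ b ∈ univ.erase a, (if ({a, x, y} : Finset V) ∈ H ∧ ({b, x, y} : Finset V) ∈ H then w H a x y else 0) := by
    intro a x y
    by_cases h : ({a, x, y} : Finset V) ∈ H
    · simp only [h, true_and, if_true]
      rw [← sum_filter, sum_const, filter_erase, card_erase_of_mem (by simpa using h), nsmul_eq_mul]
      have := D_pos H h
      change _ = (((D H x y) - 1 : ℕ) : ℝ) * _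
      rw [Nat.cast_sub this]; simp
    · simp [h]
  simp only [h1]
  calc _ = ∑ a, ∑ b ∈ univ.erase a, ∑ x, ∑ y, (if ({a, x, y} : Finset V) ∈ H ∧ ({b, x, y} : Finset V) ∈ H then w H a x y else 0) := by
        refine sum_congr rfl fun a _ => ?_
        rw [sum_comm]
        rw [sum_comm' (t' := univ) (s' := fun _ => univ) (by simp)]
        rw [sum_comm (s := univ.erase a)]
        refine sum_congr rfl fun x _ => ?_
        rw [sum_comm]
    _ ≤ ∑ a : V, ∑ b ∈ univ.erase a, (4 * t : ℝ) := by
        refine sum_le_sum fun a _ => sum_le_sum fun b hb => ?_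
        exact upper h3 hf (ne_of_mem_erase hb).symm
    _ = _ := by
        simp only [sum_const, nsmul_eq_mul, card_erase_of_mem (mem_univ _), card_univ]
        rcases Nat.eq_zero_or_pos (Fintype.card V) with h | h
        · simp [h]
        · rw [Nat.cast_sub h]; push_cast; ring

noncomputable def g (H : Finset (Finset V)) (a x y : V) : ℝ :=
  (if ({a, x, y} : Finset V) ∈ H then 2 * (((D H x y : ℝ) - 1) * w H a x y) else 0)
  + (if ({a, x, y} : Finset V) ∈ H ∧ D H a x = 1 then 1 else 0)

lemma g_nonneg (H : Finset (Finset V)) (a x y : V) : 0 ≤ g H a x y := by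
  unfold g
  have := w_nonneg H a x y
  by_cases h : ({a, x, y} : Finset V) ∈ H
  · have h1 : (1:ℝ) ≤ D H x y := by exact_mod_cast D_pos H h
    have h2 : 0 ≤ (D H x y : ℝ) - 1 := by linarith
    simp only [h, if_true]
    positivity
  · simp [h]

lemma g_ge (H : Finset (Finset V)) {a x y : V} (h : ({a, x, y} : Finset V) ∈ H)
    (h1 : D H a x ≤ D H x y) (h2 : D H a y ≤ D H x y) : 1 ≤ g H a x y := by
  have hx : 1 ≤ D H a x := D_pos H (by rw [rot]; exact h)
  have hw := w_nonneg H a x y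
  have hxy : (1:ℝ) ≤ D H x y := by exact_mod_cast D_pos H h
  have hpos : 0 ≤ ((D H x y : ℝ) - 1) * w H a x y := mul_nonneg (by linarith) hw
  unfold g
  by_cases hd : D H a x = 1
  · simp only [h, hd, if_true, and_self]; linarith
  · simp only [h, hd, if_true, and_false, if_false, add_zero]
    have hM : (max (D H a x : ℝ) (D H a y)) ≤ D H x y :=
      max_le (by exact_mod_cast h1) (by exact_mod_cast h2)
    have h2' : (2:ℝ) ≤ max (D H a x : ℝ) (D H a y) := by
      refine le_trans ?_ (le_max_left _ _)
      exact_mod_cast (by omega : 2 ≤ D H a x)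
    unfold w
    rw [← div_eq_mul_inv, mul_div_assoc', le_div_iff₀ (by linarith)]
    linarith

lemma sum_one {H : Finset (Finset V)} (h3 : ∀ e ∈ H, e.card = 3) :
    ∑ a, ∑ x, ∑ y, (if ({a, x, y} : Finset V) ∈ H ∧ D H a x = 1 then (1:ℝ) else 0)
      ≤ Fintype.card V * (Fintype.card V - 1) := by
  calc _ ≤ ∑ a : V, ∑ x : V, (if x ∈ univ.erase a then (1:ℝ) else 0) := by
        refine sum_le_sum fun a _ => sum_le_sum fun x _ => ?_
        by_cases hax : a = x
        · subst hax
          have : ∀ y, ¬ ({a, a, y} : Finset V) ∈ H := fun y h => (ne_of_mem h3 h).1 rfl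
          simp only [this, false_and, if_false, sum_const_zero]; split_ifs <;> norm_num
        · by_cases hd : D H a x = 1
          · simp only [hd, and_true]
            rw [← sum_filter, sum_const, D_eq, hd]
            simp [Ne.symm hax]
          · simp only [hd, and_false, if_false, sum_const_zero]
            split_ifs <;> norm_num
    _ = _ := by
        simp only [← sum_filter, filter_mem_eq_inter, univ_inter, sum_const, nsmul_eq_mul,
          card_erase_of_mem (mem_univ _), card_univ]
        rcases Nat.eq_zero_or_pos (Fintype.card V) with h | h
        · simp [h]
        · rw [Nat.cast_sub h]; push_cast; ring

lemma card_le_sum {H : Finset (Finset V)} (h3 : ∀ e ∈ H, e.card = 3) :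
    (H.card : ℝ) ≤ ∑ a, ∑ x, ∑ y, (if ({a, x, y} : Finset V) ∈ H then (1:ℝ) else 0) := by
  have h : H ⊆ image (fun p : V × V × V => ({p.1, p.2.1, p.2.2} : Finset V))
      (univ.filter fun p : V × V × V => ({p.1, p.2.1, p.2.2} : Finset V) ∈ H) := by
    intro e he
    obtain ⟨a, x, y, -, -, -, rfl⟩ := card_eq_three.1 (h3 e he)
    exact mem_image.2 ⟨(a, x, y), by simpa using he, rfl⟩
  have h' := (card_le_card h).trans card_image_le
  have : ∑ a, ∑ x, ∑ y, (if ({a, x, y} : Finset V) ∈ H then (1:ℝ) else 0)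
      = ((univ.filter fun p : V × V × V => ({p.1, p.2.1, p.2.2} : Finset V) ∈ H).card : ℝ) := by
    rw [card_filter]; push_cast
    rw [Fintype.sum_prod_type]
    refine sum_congr rfl fun a _ => ?_
    rw [Fintype.sum_prod_type]
  rw [this]; exact_mod_cast h'

lemma main {H : Finset (Finset V)} (h3 : ∀ e ∈ H, e.card = 3) {t : ℕ} (hf : ¬ hasK2t3 t H) :
    (H.card : ℝ) ≤ (24 * t + 3) * (Fintype.card V * (Fintype.card V - 1)) := by
  have hg : ∑ a, ∑ x, ∑ y, g H a x y ≤ (8 * t + 1) * (Fintype.card V * (Fintype.card V - 1)) := by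
    have e1 := upper_sum h3 hf
    have e2 := sum_one h3
    have : ∑ a, ∑ x, ∑ y, g H a x y = 2 * (∑ a, ∑ x, ∑ y, (if ({a, x, y} : Finset V) ∈ H then ((D H x y : ℝ) - 1) * w H a x y else 0)) + ∑ a, ∑ x, ∑ y, (if ({a, x, y} : Finset V) ∈ H ∧ D H a x = 1 then (1:ℝ) else 0) := by
      unfold g
      simp only [sum_add_distrib, mul_sum, mul_ite, mul_zero]
    rw [this]; nlinarith
  have pt : ∀ a x y, (if ({a, x, y} : Finset V) ∈ H then (1:ℝ) else 0)
      ≤ g H a x y + g H x y a + g H y a x := by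
    intro a x y
    have n1 := g_nonneg H a x y
    have n2 := g_nonneg H x y a
    have n3 := g_nonneg H y a x
    split_ifs with h
    · have h' : ({x, y, a} : Finset V) ∈ H := by rw [← rot]; exact h
      have h'' : ({y, a, x} : Finset V) ∈ H := by rw [← rot]; exact h'
      have s1 := D_symm H a x
      have s2 := D_symm H a y
      have s3 := D_symm H x y
      have g1 := g_ge H h
      have g2 := g_ge H h'
      have g3 := g_ge H h''
      by_cases c1 : D H a x ≤ D H x y ∧ D H a y ≤ D H x y
      · linarith [g1 c1.1 c1.2]
      · by_cases c2 : D H x y ≤ D H y a ∧ D H x a ≤ D H y a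
        · linarith [g2 c2.1 c2.2]
        · linarith [g3 (by omega) (by omega)]
    · positivity
  have r1 : ∑ a, ∑ x, ∑ y, g H x y a = ∑ a, ∑ x, ∑ y, g H a x y := by
    rw [sum_comm]
    refine sum_congr rfl fun x _ => ?_
    rw [sum_comm]
  have r2 : ∑ a, ∑ x, ∑ y, g H y a x = ∑ a, ∑ x, ∑ y, g H a x y := by
    rw [← r1]
    rw [sum_comm]
    symm
    calc _ = ∑ x, ∑ a, ∑ y, g H x y a := sum_comm
      _ = ∑ x, ∑ y, ∑ a, g H x y a := sum_congr rfl fun x _ => sum_comm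
      _ = ∑ y, ∑ x, ∑ a, g H x y a := sum_comm
      _ = ∑ y, ∑ a, ∑ x, g H x y a := sum_congr rfl fun x _ => sum_comm
      _ = _ := sum_comm
  calc (H.card : ℝ) ≤ _ := card_le_sum h3
    _ ≤ ∑ a, ∑ x, ∑ y, (g H a x y + g H x y a + g H y a x) :=
      sum_le_sum fun a _ => sum_le_sum fun x _ => sum_le_sum fun y _ => pt a x y
    _ = 3 * ∑ a, ∑ x, ∑ y, g H a x y := by
      simp only [sum_add_distrib]; rw [r1, r2]; ring
    _ ≤ _ := by linarith

lemma ex_le (t n : ℕ) (ht : 2 ≤ t) : exK2t3 t n ≤ 80 * t * n.choose 2 := by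
  refine csSup_le' ?_
  rintro m ⟨H, h3, hf, rfl⟩
  have h := main h3 hf
  rw [Fintype.card_fin] at h
  have hc : (n.choose 2 : ℝ) = n * (n - 1) / 2 := Nat.cast_choose_two ℝ n
  have ht' : (2:ℝ) ≤ t := by exact_mod_cast ht
  have h0 : (0:ℝ) ≤ n.choose 2 := by positivity
  have : (H.card : ℝ) ≤ 80 * t * n.choose 2 := by
    have e : (n:ℝ) * (n - 1) = 2 * n.choose 2 := by rw [hc]; ring
    rw [e] at h
    nlinarith
  exact_mod_cast this

end K2t

/-- For every integer `t ≥ 2`, the limit superior as `n → ∞` of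
`ex(n, K_{2,t}^{(3)}) / C(n,2)` is at most `30 t log₂ t + 80 t`. -/
theorem limsup_exK2t3_div_choose_le (t : ℕ) (ht : 2 ≤ t) :
    Filter.limsup (fun n : ℕ => (exK2t3 t n : ℝ) / (n.choose 2 : ℝ)) Filter.atTop
      ≤ 30 * t * Real.logb 2 t + 80 * t := by
  have ht' : (2:ℝ) ≤ t := by exact_mod_cast ht
  have hlog : 0 ≤ Real.logb 2 t := Real.logb_nonneg (by norm_num) (by linarith)
  refine Filter.limsup_le_of_le ?_ (Filter.Eventually.of_forall fun n => ?_)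
  · exact Filter.isCoboundedUnder_le_of_le Filter.atTop (x := 0) (fun n => by positivity)
  · have h : (exK2t3 t n : ℝ) ≤ 80 * t * n.choose 2 := by exact_mod_cast K2t.ex_le t n ht
    have h1 : (exK2t3 t n : ℝ) / (n.choose 2 : ℝ) ≤ 80 * t :=
      div_le_of_le_mul₀ (by positivity) (by positivity) h
    have h2 : 0 ≤ 30 * (t:ℝ) * Real.logb 2 t := by positivity
    linarith
end

section
/- Let G be an edge-colored multigraph with e edges such that every pair of vertices is covered by at most p edges (counted with multiplicity) and every color class contains at most q edges. If G contains no t-frame, then the total number of edges of G is at most binom(t−1, 2)·p + t·q. -/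
/-- (Frame lemma.) Let `G` be an edge-colored multigraph, given by a finite index type
`ι` of edges, where edge `i` lies on the (non-diagonal) pair of vertices `E i` and has
color `c i`. Assume each pair of vertices carries at most `p` edges and each color class
has at most `q` edges. A `t`-frame is a collection of `t` edges with pairwise distinct
colors together with a choice of one endpoint from each edge such that the chosen
endpoints are pairwise distinct. If `G` contains no `t`-frame, then the total number of
edges is at most `C(t-1, 2)·p + t·q`. -/
theorem frame_lemma {V C ι : Type*} [Fintype ι] [DecidableEq V] [DecidableEq C]
    (E : ι → Sym2 V) (hE : ∀ i, ¬ (E i).IsDiag)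
    (c : ι → C) (p q t : ℕ) (ht : 1 ≤ t)
    (hmult : ∀ s : Sym2 V, (Finset.univ.filter (fun i => E i = s)).card ≤ p)
    (hcolor : ∀ col : C, (Finset.univ.filter (fun i => c i = col)).card ≤ q)
    (hframe : ¬ ∃ f : Fin t → ι, Function.Injective (c ∘ f) ∧
        ∃ x : Fin t → V, Function.Injective x ∧ ∀ j, x j ∈ E (f j)) :
    Fintype.card ι ≤ (t - 1).choose 2 * p + t * q := by
  classical
  let I : Finset C := Finset.univ.image c
  let N : C → Finset V := fun col =>
    (Finset.univ.filter (fun i => c i = col)).biUnion (fun i => (E i).toFinset)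
  have hN : ∀ col v, v ∈ N col ↔ ∃ i, c i = col ∧ v ∈ E i := by
    intro col v
    simp [N]
  have colcount : ∀ K : Finset C, (Finset.univ.filter (fun i => c i ∈ K)).card ≤ q * K.card := by
    intro K
    apply Finset.card_le_mul_card_image_of_maps_to (f := c)
    · intro i hi
      simpa using hi
    · intro b _
      exact (Finset.card_le_card (by intro i; simp)).trans (hcolor b)
  by_cases hn : I.card < t
  · have h1 := colcount I
    have h2 : (Finset.univ.filter (fun i => c i ∈ I)) = Finset.univ := by
      ext i; simp [I]
    rw [h2, Finset.card_univ] at h1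
    have h3 : q * I.card ≤ t * q := by
      rw [mul_comm t q]; exact Nat.mul_le_mul_left _ hn.le
    omega
  push Not at hn
  obtain ⟨d, hd⟩ := Nat.exists_eq_add_of_le hn
  let T : I → Finset (V ⊕ Fin d) := fun x => (N x.1).disjSum Finset.univ
  by_cases hall : ∀ s : Finset I, s.card ≤ (s.biUnion T).card
  · exfalso
    obtain ⟨f, hf, hfT⟩ := (Finset.all_card_le_biUnion_card_iff_exists_injective T).1 hall
    let L : Finset I := Finset.univ.filter (fun x => ∃ v, f x = Sum.inl v)
    let R : Finset I := Finset.univ.filter (fun x => ¬ ∃ v, f x = Sum.inl v)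
    have hLR : L.card + R.card = I.card := by
      have := Finset.card_filter_add_card_filter_not (s := (Finset.univ : Finset I))
        (fun x => ∃ v, f x = Sum.inl v)
      simpa [L, R] using this
    have hR : R.card ≤ d := by
      have h : (R.image f).card ≤ ((Finset.univ : Finset (Fin d)).image
          (Sum.inr : Fin d → V ⊕ Fin d)).card := by
        apply Finset.card_le_card
        intro y hy
        obtain ⟨x, hx, rfl⟩ := Finset.mem_image.1 hy
        have hx' := (Finset.mem_filter.1 hx).2
        rcases hfx : f x with v | w
        · exact absurd ⟨v, hfx⟩ hx'
        · simp
      rw [Finset.card_image_of_injective _ hf] at h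
      exact h.trans (Finset.card_image_le.trans (by simp))
    have hL : t ≤ L.card := by omega
    obtain ⟨g⟩ : Nonempty (Fin t ↪ L) := by
      apply Function.Embedding.nonempty_of_card_le
      simpa using hL
    have hv : ∀ j, ∃ v, f (g j).1 = Sum.inl v := fun j => (Finset.mem_filter.1 (g j).2).2
    choose x hx using hv
    have he : ∀ j, ∃ i, c i = (g j).1.1 ∧ x j ∈ E i := by
      intro j
      rw [← hN]
      have := hfT (g j).1
      rw [hx] at this
      simpa [T] using this
    choose e he1 he2 using he
    refine hframe ⟨e, ?_, x, ?_, he2⟩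
    · intro a b hab
      simp only [Function.comp, he1] at hab
      exact g.injective (Subtype.ext (Subtype.ext hab))
    · intro a b hab
      apply g.injective
      apply Subtype.ext
      apply hf
      rw [hx, hx, hab]
  · push Not at hall
    obtain ⟨S, hS⟩ := hall
    let S' : Finset C := S.map (Function.Embedding.subtype _)
    have hS' : S' ⊆ I := by
      intro y hy
      obtain ⟨x, _, rfl⟩ := Finset.mem_map.1 hy
      exact x.2
    have hcS : S'.card = S.card := Finset.card_map _
    let A : Finset V := S'.biUnion N
    have hbi : A.card + d ≤ (S.biUnion T).card := by
      have hne : S.Nonempty := by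
        rw [Finset.nonempty_iff_ne_empty]; rintro rfl; simp at hS
      obtain ⟨x0, hx0⟩ := hne
      have : (A.disjSum (Finset.univ : Finset (Fin d))).card ≤ (S.biUnion T).card := by
        apply Finset.card_le_card
        intro y hy
        rcases y with v | w
        · rw [Finset.inl_mem_disjSum] at hy
          obtain ⟨z, hz, hv⟩ := Finset.mem_biUnion.1 hy
          obtain ⟨x, hx, rfl⟩ := Finset.mem_map.1 hz
          exact Finset.mem_biUnion.2 ⟨x, hx, Finset.inl_mem_disjSum.2 hv⟩
        · exact Finset.mem_biUnion.2 ⟨x0, hx0, Finset.inr_mem_disjSum.2 (Finset.mem_univ _)⟩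
      simpa using this
    have hK := Finset.card_sdiff_add_card_eq_card hS'
    have h1 := colcount (I \ S')
    have h2 : (Finset.univ.filter (fun i => c i ∉ I \ S')).card ≤ p * A.card.choose 2 := by
      rw [← Sym2.card_image_offDiag]
      apply Finset.card_le_mul_card_image_of_maps_to (f := E)
      · intro i hi
        have hiS : c i ∈ S' := by
          by_contra h
          exact (Finset.mem_filter.1 hi).2 (Finset.mem_sdiff.2 ⟨by simp [I], h⟩)
        have hA : ∀ v ∈ E i, v ∈ A := fun v hv =>
          Finset.mem_biUnion.2 ⟨c i, hiS, (hN _ _).2 ⟨i, rfl, hv⟩⟩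
        have hd := hE i
        generalize E i = s at hA hd
        induction s using Sym2.ind with
        | _ a b =>
          refine Finset.mem_image.2 ⟨(a, b), ?_, rfl⟩
          exact Finset.mem_offDiag.2 ⟨hA a (by simp), hA b (by simp), by simpa using hd⟩
      · intro b _
        exact (Finset.card_le_card (by intro i; simp)).trans (hmult b)
    have h3 := Finset.card_filter_add_card_filter_not (s := (Finset.univ : Finset ι))
        (fun i => c i ∈ I \ S')
    rw [Finset.card_univ] at h3
    have h4 : p * A.card.choose 2 ≤ (t - 1).choose 2 * p := by
      rw [mul_comm]
      exact Nat.mul_le_mul_right _ (Nat.choose_le_choose _ (by omega))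
    have h5 : q * (I \ S').card ≤ t * q := by
      rw [mul_comm]
      exact Nat.mul_le_mul_right _ (by omega)
    omega
end

section
/- Let t ≥ 2 and q ≥ t be integers, and let H be a 3-partite 3-uniform hypergraph with parts A, B, C, where C = {c_1, …, c_n}, containing no copy of K_{2,t}^{(3)}. For each i ∈ {1, …, n}, let G_i be the bipartite link graph of c_i, with parts A and B and edge set {ab : a ∈ A, b ∈ B, {a,b,c_i} ∈ H}. Then for any two distinct vertices u, v both in A (or both in B), the number of indices i ∈ {1, …, n} such that u and v have at least q common neighbors in G_i is less than t. -/
theorem dense_aux {V : Type*} [DecidableEq V] (t q n : ℕ) (hq : t ≤ q)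
    (D : Finset V) (c : Fin n → V) (hc : Function.Injective c) (hcD : ∀ i, c i ∉ D)
    (u v : V) (huv : u ≠ v) (hu : u ∉ D) (hv : v ∉ D)
    (hcu : ∀ i, c i ≠ u) (hcv : ∀ i, c i ≠ v) (H : Finset (Finset V))
    (hfree : ¬ hasK2t3 t H) (P : V → Fin n → Prop) [∀ i, DecidablePred (fun b => P b i)]
    (hP : ∀ b i, P b i → ({u, b, c i} : Finset V) ∈ H ∧ ({v, b, c i} : Finset V) ∈ H) :
    (Finset.univ.filter (fun i : Fin n => q ≤ (D.filter (fun b => P b i)).card)).card < t := by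
  by_contra hlt
  push Not at hlt
  obtain ⟨S, hS, hSc⟩ := Finset.exists_subset_card_eq hlt
  let e : Fin t ≃ S := (S.equivFinOfCardEq hSc).symm
  have he : ∀ j, q ≤ (D.filter (fun b => P b (e j))).card := fun j =>
    (Finset.mem_filter.1 (hS (e j).2)).2
  obtain ⟨f, hf, hfm⟩ := (Finset.all_card_le_biUnion_card_iff_exists_injective
    (fun j : Fin t => D.filter (fun b => P b (e j)))).1 (by
      intro s
      rcases s.eq_empty_or_nonempty with rfl | ⟨j, hj⟩
      · simp
      · calc s.card ≤ t := by simpa using s.card_le_univ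
          _ ≤ _ := hq.trans (he j)
          _ ≤ _ := Finset.card_le_card
            (Finset.subset_biUnion_of_mem (fun j : Fin t => D.filter (fun b => P b (e j))) hj))
  have hfD : ∀ j, f j ∈ D := fun j => (Finset.mem_filter.1 (hfm j)).1
  refine hfree ⟨u, v, f, fun j => c (e j), ?_, fun j => hP _ _ (Finset.mem_filter.1 (hfm j)).2⟩
  have hg : Function.Injective (fun j => c (e j)) :=
    hc.comp (Subtype.val_injective.comp e.injective)
  rw [Finset.card_union_of_disjoint, Finset.card_union_of_disjoint,
    Finset.card_image_of_injective _ hf, Finset.card_image_of_injective _ hg,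
    Finset.card_pair huv]
  · simp; omega
  · rw [Finset.disjoint_left]
    intro x hx hx'
    obtain ⟨j, -, rfl⟩ := Finset.mem_image.1 hx'
    have := hfD j
    simp only [Finset.mem_insert, Finset.mem_singleton] at hx
    rcases hx with h | h <;> rw [h] at this <;> contradiction
  · rw [Finset.disjoint_left]
    intro x hx hx'
    obtain ⟨j, -, rfl⟩ := Finset.mem_image.1 hx'
    simp only [Finset.mem_union, Finset.mem_insert, Finset.mem_singleton, Finset.mem_image] at hx
    rcases hx with (h | h) | ⟨k, -, h⟩
    · exact hcu _ h
    · exact hcv _ h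
    · exact hcD _ (h ▸ hfD k)

/-- Let `t ≥ 2` and `q ≥ t`, and let `H` be a `K_{2,t}^{(3)}`-free 3-partite 3-uniform
hypergraph with parts `A`, `B` and `C = {c 1, …, c n}` (so each edge is `{a, b, c i}`
with `a ∈ A`, `b ∈ B`).  For `i ∈ {1,…,n}`, the link graph `G i` of `c i` is the
bipartite graph with parts `A`, `B` and edges `ab` with `{a, b, c i} ∈ H`.  Then for any
two distinct vertices `u, v` both in `A` (resp. both in `B`), the number of indices `i`
such that `u` and `v` have at least `q` common neighbors in `G i` is less than `t`. -/
theorem dense_pair_multiplicity {V : Type*} [DecidableEq V] (t q n : ℕ)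
    (ht : 2 ≤ t) (hq : t ≤ q)
    (A B : Finset V) (c : Fin n → V) (hc : Function.Injective c)
    (hAB : Disjoint A B) (hcA : ∀ i, c i ∉ A) (hcB : ∀ i, c i ∉ B)
    (H : Finset (Finset V))
    (hpart : ∀ e ∈ H, ∃ a ∈ A, ∃ b ∈ B, ∃ i : Fin n, e = {a, b, c i})
    (hfree : ¬ hasK2t3 t H) :
    (∀ u ∈ A, ∀ v ∈ A, u ≠ v →
      (Finset.univ.filter (fun i : Fin n =>
        q ≤ (B.filter (fun b =>
          ({u, b, c i} : Finset V) ∈ H ∧ ({v, b, c i} : Finset V) ∈ H)).card)).card < t) ∧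
    (∀ u ∈ B, ∀ v ∈ B, u ≠ v →
      (Finset.univ.filter (fun i : Fin n =>
        q ≤ (A.filter (fun a =>
          ({a, u, c i} : Finset V) ∈ H ∧ ({a, v, c i} : Finset V) ∈ H)).card)).card < t) := by
  constructor
  · intro u hu v hv huv
    exact dense_aux t q n hq B c hc hcB u v huv (Finset.disjoint_left.1 hAB hu)
      (Finset.disjoint_left.1 hAB hv) (fun i h => hcA i (h ▸ hu)) (fun i h => hcA i (h ▸ hv))
      H hfree (fun b i => ({u, b, c i} : Finset V) ∈ H ∧ ({v, b, c i} : Finset V) ∈ H)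
      (fun b i h => h)
  · intro u hu v hv huv
    exact dense_aux t q n hq A c hc hcA u v huv (Finset.disjoint_right.1 hAB hu)
      (Finset.disjoint_right.1 hAB hv) (fun i h => hcB i (h ▸ hu)) (fun i h => hcB i (h ▸ hv))
      H hfree (fun a i => ({a, u, c i} : Finset V) ∈ H ∧ ({a, v, c i} : Finset V) ∈ H)
      (fun b i h => by rwa [Finset.insert_comm u, Finset.insert_comm v])
end

section
/- Let t ≥ 2 and q ≥ 1 be integers, and let H be a 3-partite 3-uniform hypergraph with parts A, B, C, where C = {c_1, …, c_n}, containing no copy of K_{2,t}^{(3)} and no copy of K_{1,2,q}. For each i ∈ {1, …, n}, let G_i be the bipartite link graph of c_i, with parts A and B and edge set {ab : a ∈ A, b ∈ B, {a,b,c_i} ∈ H}, and let N_i(u,v) denote the set of common neighbors of u and v in G_i. Then for any two distinct vertices u, v ∈ A, the sum over i = 1, …, n of |N_i(u,v)| is less than q·t. -/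
/-- A 3-uniform hypergraph `H` contains a copy of `K_{1,2,q}`: there are distinct
vertices `x, a₁, a₂, y_1, …, y_q` (i.e. `q+3` distinct vertices) such that all the
triples `{x, a₁, y i}` and `{x, a₂, y i}` are edges of `H`. -/
def hasK12q {V : Type*} [DecidableEq V] (q : ℕ) (H : Finset (Finset V)) : Prop :=
  ∃ (x a₁ a₂ : V) (y : Fin q → V),
    ({x, a₁, a₂} ∪ Finset.image y Finset.univ).card = q + 3 ∧
    ∀ i : Fin q,
      ({x, a₁, y i} : Finset V) ∈ H ∧ ({x, a₂, y i} : Finset V) ∈ H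

theorem exists_matching_aux {α β : Type*} [DecidableEq α] [DecidableEq β] (t q : ℕ) (hq : 1 ≤ q)
    (P : Finset (α × β))
    (h1 : ∀ a, (P.filter (fun p => p.1 = a)).card ≤ q)
    (h2 : ∀ b, (P.filter (fun p => p.2 = b)).card ≤ q)
    (hP : q * t ≤ P.card) :
    ∃ (x : Fin t → α) (y : Fin t → β), Function.Injective x ∧ Function.Injective y ∧
      ∀ i, (x i, y i) ∈ P := by
  classical
  set B := P.image Prod.fst with hB
  have hfib1 : ∀ S : Finset α, (P.filter (fun p => p.1 ∈ S)).card ≤ q * S.card := by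
    intro S
    refine Finset.card_le_mul_card_image_of_maps_to (f := Prod.fst) (t := S) ?_ q ?_
    · intro p hp; exact (Finset.mem_filter.1 hp).2
    · intro a _
      refine le_trans (Finset.card_le_card ?_) (h1 a)
      intro p hp
      simp only [Finset.mem_filter] at hp ⊢
      exact ⟨hp.1.1, hp.2⟩
  have hfib2 : ∀ S : Finset β, (P.filter (fun p => p.2 ∈ S)).card ≤ q * S.card := by
    intro S
    refine Finset.card_le_mul_card_image_of_maps_to (f := Prod.snd) (t := S) ?_ q ?_
    · intro p hp; exact (Finset.mem_filter.1 hp).2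
    · intro a _
      refine le_trans (Finset.card_le_card ?_) (h2 a)
      intro p hp
      simp only [Finset.mem_filter] at hp ⊢
      exact ⟨hp.1.1, hp.2⟩
  have hPB : P.filter (fun p => p.1 ∈ B) = P := by
    apply Finset.filter_true_of_mem
    intro p hp
    exact Finset.mem_image_of_mem _ hp
  have htB : t ≤ B.card := by
    have := hfib1 B
    rw [hPB] at this
    exact Nat.le_of_mul_le_mul_left (hP.trans this) hq
  let N : α → Finset β := fun a => (P.filter (fun p => p.1 = a)).image Prod.snd
  let T : B → Finset (β ⊕ Fin (B.card - t)) := fun a => (N a.1).disjSum Finset.univ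
  have hall : ∀ s : Finset B, s.card ≤ (s.biUnion T).card := by
    intro s
    rcases s.eq_empty_or_nonempty with rfl | ⟨a0, ha0⟩
    · simp
    set S : Finset α := s.image Subtype.val with hS
    have hSc : S.card = s.card := Finset.card_image_of_injective _ Subtype.val_injective
    have hSB : S ⊆ B := by
      intro a ha
      obtain ⟨a', _, rfl⟩ := Finset.mem_image.1 ha
      exact a'.2
    have e1 : (s.biUnion T) = (S.biUnion N).disjSum Finset.univ := by
      ext z
      rcases z with z | z
      · simp [T, hS]
      · simp only [T, Finset.mem_biUnion, Finset.inr_mem_disjSum, Finset.mem_univ, and_true, iff_true]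
        exact ⟨a0, ha0⟩
    rw [e1, Finset.card_disjSum, Finset.card_univ, Fintype.card_fin, ← hSc]
    have e2 : P.card ≤ q * (B \ S).card + q * (S.biUnion N).card := by
      refine le_trans ?_ (Nat.add_le_add (hfib1 _) (hfib2 _))
      refine le_trans (Finset.card_le_card ?_) (Finset.card_union_le _ _)
      intro p hp
      by_cases hpS : p.1 ∈ S
      · apply Finset.mem_union_right
        rw [Finset.mem_filter]
        refine ⟨hp, Finset.mem_biUnion.2 ⟨p.1, hpS, ?_⟩⟩
        exact Finset.mem_image.2 ⟨p, Finset.mem_filter.2 ⟨hp, rfl⟩, rfl⟩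
      · apply Finset.mem_union_left
        rw [Finset.mem_filter]
        exact ⟨hp, Finset.mem_sdiff.2 ⟨Finset.mem_image_of_mem _ hp, hpS⟩⟩
    rw [← mul_add] at e2
    have e3 := Nat.le_of_mul_le_mul_left (hP.trans e2) hq
    have e4 := Finset.card_sdiff_add_card_eq_card hSB
    omega
  obtain ⟨f, hf, hfT⟩ := (Finset.all_card_le_biUnion_card_iff_exists_injective T).1 hall
  set L : Finset B := Finset.univ.filter (fun a => (f a).isLeft = true) with hL
  have hR : (Finset.univ.filter (fun a => ¬ (f a).isLeft = true)).card ≤ B.card - t := by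
    have : ((Finset.univ.filter (fun a => ¬ (f a).isLeft = true)).image f).card ≤
        ((Finset.univ : Finset (Fin (B.card - t))).image (Sum.inr : _ → β ⊕ _)).card := by
      apply Finset.card_le_card
      intro z hz
      obtain ⟨a, ha, rfl⟩ := Finset.mem_image.1 hz
      have := (Finset.mem_filter.1 ha).2
      rcases hfa : f a with w | w
      · simp [hfa] at this
      · simp
    rw [Finset.card_image_of_injective _ hf] at this
    refine this.trans (Finset.card_image_le.trans ?_)
    simp
  have hLc : t ≤ L.card := by
    have := Finset.card_filter_add_card_filter_not (s := (Finset.univ : Finset B)) (fun a => (f a).isLeft = true)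
    rw [Finset.card_univ, Fintype.card_coe] at this
    change L.card + _ = _ at this
    omega
  obtain ⟨g⟩ : Nonempty (Fin t ↪ L) := by
    rw [Function.Embedding.nonempty_iff_card_le]
    simpa using hLc
  have key : ∀ i : Fin t, ∃ b, f (g i).1 = Sum.inl b := by
    intro i
    have := (Finset.mem_filter.1 (g i).2).2
    exact Sum.isLeft_iff.1 this
  choose y hy using key
  refine ⟨fun i => (g i).1.1, y, ?_, ?_, ?_⟩
  · intro i j h
    exact g.injective (Subtype.ext (Subtype.ext h))
  · intro i j h
    have : f (g i).1 = f (g j).1 := by rw [hy, hy, h]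
    exact g.injective (Subtype.ext (hf this))
  · intro i
    have := hfT (g i).1
    rw [hy] at this
    simpa [T, N] using this

theorem exists_fin_embedding_aux {α : Type*} (q : ℕ) (s : Finset α) (h : q ≤ s.card) :
    ∃ x : Fin q → α, Function.Injective x ∧ ∀ i, x i ∈ s := by
  obtain ⟨g⟩ : Nonempty (Fin q ↪ s) := by
    rw [Function.Embedding.nonempty_iff_card_le]
    simpa using h
  exact ⟨fun i => (g i).1, fun i j h => g.injective (Subtype.ext h), fun i => (g i).2⟩

theorem swap12_aux {V : Type*} [DecidableEq V] (a b c : V) :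
    ({a, b, c} : Finset V) = {b, a, c} := Finset.insert_comm _ _ _

theorem rot_aux {V : Type*} [DecidableEq V] (a b c : V) :
    ({a, b, c} : Finset V) = {c, a, b} := by
  ext x; simp only [Finset.mem_insert, Finset.mem_singleton]; tauto

theorem card12q_aux {V : Type*} [DecidableEq V] (q : ℕ) (x u v : V) (y : Fin q → V)
    (hy : Function.Injective y) (hxu : x ≠ u) (hxv : x ≠ v) (huv : u ≠ v)
    (h1 : ∀ i, y i ≠ x) (h2 : ∀ i, y i ≠ u) (h3 : ∀ i, y i ≠ v) :
    ({x, u, v} ∪ Finset.image y Finset.univ).card = q + 3 := by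
  rw [Finset.card_union_of_disjoint, Finset.card_image_of_injective _ hy,
    Finset.card_eq_three.2 ⟨x, u, v, hxu, hxv, huv, rfl⟩, Finset.card_univ, Fintype.card_fin,
    add_comm]
  rw [Finset.disjoint_right]
  intro z hz
  obtain ⟨i, _, rfl⟩ := Finset.mem_image.1 hz
  simp [h1, h2, h3]

/-- Let `t ≥ 2` and `q ≥ 1`, and let `H` be a 3-partite 3-uniform hypergraph with parts
`A`, `B`, `C = {c 1, …, c n}` containing no copy of `K_{2,t}^{(3)}` and no copy of
`K_{1,2,q}`.  For `i ∈ {1,…,n}`, let `G i` be the bipartite link graph of `c i` (with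
parts `A`, `B`, edges `ab` with `{a, b, c i} ∈ H`), and let `N i u v` be the set of
common neighbors of `u` and `v` in `G i`.  Then for any two distinct `u, v ∈ A`,
`∑ i, |N i u v| < q·t`. -/
theorem sum_common_neighbors_lt {V : Type*} [DecidableEq V] (t q n : ℕ)
    (ht : 2 ≤ t) (hq : 1 ≤ q)
    (A B : Finset V) (c : Fin n → V) (hc : Function.Injective c)
    (hAB : Disjoint A B) (hcA : ∀ i, c i ∉ A) (hcB : ∀ i, c i ∉ B)
    (H : Finset (Finset V))
    (hpart : ∀ e ∈ H, ∃ a ∈ A, ∃ b ∈ B, ∃ i : Fin n, e = {a, b, c i})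
    (hfree : ¬ hasK2t3 t H) (hfree' : ¬ hasK12q q H) :
    ∀ u ∈ A, ∀ v ∈ A, u ≠ v →
      (∑ i : Fin n, (B.filter (fun b =>
        ({u, b, c i} : Finset V) ∈ H ∧ ({v, b, c i} : Finset V) ∈ H)).card) < q * t := by
  classical
  intro u hu v hv huv
  by_contra hcon
  rw [not_lt] at hcon
  set P : Finset (V × Fin n) := (B ×ˢ Finset.univ).filter (fun p =>
    ({u, p.1, c p.2} : Finset V) ∈ H ∧ ({v, p.1, c p.2} : Finset V) ∈ H) with hPdef
  have memP : ∀ p, p ∈ P ↔ p.1 ∈ B ∧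
      ({u, p.1, c p.2} : Finset V) ∈ H ∧ ({v, p.1, c p.2} : Finset V) ∈ H := by
    intro p; simp [hPdef]
  have hAneB : ∀ a ∈ A, ∀ b ∈ B, b ≠ a := fun a ha b hb h =>
    Finset.disjoint_left.1 hAB ha (h ▸ hb)
  have hcneA : ∀ a ∈ A, ∀ i, c i ≠ a := fun a ha i h => hcA i (h ▸ ha)
  have hcneB : ∀ b ∈ B, ∀ i, c i ≠ b := fun b hb i h => hcB i (h ▸ hb)
  have hPcard : P.card = ∑ i : Fin n, (B.filter (fun b =>
        ({u, b, c i} : Finset V) ∈ H ∧ ({v, b, c i} : Finset V) ∈ H)).card := by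
    rw [hPdef, Finset.card_filter, Finset.sum_product_right]
    simp only [Finset.card_filter]
  obtain ⟨x, y, hx, hy, hxy⟩ := exists_matching_aux t q hq P (by
      intro b
      by_contra hlt
      rw [not_le] at hlt
      obtain ⟨y, hy, hyP⟩ := exists_fin_embedding_aux q _ hlt.le
      have hyP' : ∀ i, y i ∈ P ∧ (y i).1 = b := fun i => by simpa using hyP i
      have hb : b ∈ B := by
        have h := hyP' ⟨0, hq⟩
        exact h.2 ▸ ((memP _).1 h.1).1
      refine hfree' ⟨b, u, v, fun i => c (y i).2, card12q_aux _ _ _ _ _ ?_ (hAneB u hu b hb)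
        (hAneB v hv b hb) huv (fun i => hcneB b hb _) (fun i => hcneA u hu _)
        (fun i => hcneA v hv _), ?_⟩
      · intro i j h
        exact hy (Prod.ext ((hyP' i).2.trans (hyP' j).2.symm) (hc h))
      · intro i
        have h := ((memP _).1 (hyP' i).1).2
        rw [(hyP' i).2] at h
        rw [swap12_aux b u, swap12_aux b v]
        exact h) (by
      intro k
      by_contra hlt
      rw [not_le] at hlt
      obtain ⟨y, hy, hyP⟩ := exists_fin_embedding_aux q _ hlt.le
      have hyP' : ∀ i, y i ∈ P ∧ (y i).2 = k := fun i => by simpa using hyP i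
      have hyB : ∀ i, (y i).1 ∈ B := fun i => ((memP _).1 (hyP' i).1).1
      refine hfree' ⟨c k, u, v, fun i => (y i).1, card12q_aux _ _ _ _ _ ?_ (hcneA u hu k)
        (hcneA v hv k) huv (fun i => (hcneB _ (hyB i) k).symm) (fun i => hAneB u hu _ (hyB i))
        (fun i => hAneB v hv _ (hyB i)), ?_⟩
      · intro i j h
        exact hy (Prod.ext h ((hyP' i).2.trans (hyP' j).2.symm))
      · intro i
        have h := ((memP _).1 (hyP' i).1).2
        rw [(hyP' i).2] at h
        rw [← rot_aux u, ← rot_aux v]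
        exact h) (hPcard ▸ hcon)
  have hxB : ∀ i, x i ∈ B := fun i => ((memP _).1 (hxy i)).1
  refine hfree ⟨u, v, x, fun i => c (y i), ?_, fun i => ((memP _).1 (hxy i)).2⟩
  have hcy : Function.Injective (fun i => c (y i)) := hc.comp hy
  rw [Finset.card_union_of_disjoint, Finset.card_union_of_disjoint,
    Finset.card_image_of_injective _ hx, Finset.card_image_of_injective _ hcy,
    Finset.card_pair huv, Finset.card_univ, Fintype.card_fin]
  · omega
  · rw [Finset.disjoint_right]
    intro z hz
    obtain ⟨i, _, rfl⟩ := Finset.mem_image.1 hz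
    simp [hAneB u hu _ (hxB i), hAneB v hv _ (hxB i)]
  · rw [Finset.disjoint_right]
    intro z hz
    obtain ⟨i, _, rfl⟩ := Finset.mem_image.1 hz
    have h3 : ∀ j, x j ≠ c (y i) := fun j => (hcneB _ (hxB j) _).symm
    simp [hcneA u hu, hcneA v hv, h3]
end

section
/- For every integer t ≥ 2 and every real ε > 0 there exists N such that for all n ≥ N, ex(n, K_{2,t}^{(4)}) ≥ (1 − ε) · ((t−1)/8) · n³. -/
/-- A 4-uniform hypergraph `H` contains a copy of `K_{2,t}^{(4)}`: there are distinct
vertices `a, b, x_1, …, x_t, y_1, …, y_t, z_1, …, z_t` (i.e. `3t+2` distinct vertices)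
such that all the quadruples `{a, x i, y i, z i}` and `{b, x i, y i, z i}` are edges of
`H`. -/
def hasK2t4 {V : Type*} [DecidableEq V] (t : ℕ) (H : Finset (Finset V)) : Prop :=
  ∃ (a b : V) (x y z : Fin t → V),
    ({a, b} ∪ Finset.image x Finset.univ ∪ Finset.image y Finset.univ
      ∪ Finset.image z Finset.univ).card = 3 * t + 2 ∧
    ∀ i : Fin t,
      ({a, x i, y i, z i} : Finset V) ∈ H ∧ ({b, x i, y i, z i} : Finset V) ∈ H

namespace K2t4

set_option linter.unusedSectionVars false

section abstractPart

variable {V C D : Type} [Fintype V] [Fintype C] [Fintype D] [DecidableEq V] [DecidableEq C]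
  [DecidableEq D]

/-- `z` is an `i`-neighbour of `a`. -/
def EE (nb : C → V → D → V) (i : C) (a z : V) : Prop := ∃ d, nb i a d = z

/-- equal or adjacent in some colour -/
def QQ (nb : C → V → D → V) (a x : V) : Prop := a = x ∨ ∃ i, EE nb i a x

/-- the good tuples -/
def Good (nb : C → V → D → V) (i : C) (a z x y : V) : Prop :=
  EE nb i a z ∧ EE nb i x y ∧ a ≠ z ∧ x ≠ y ∧ ¬ QQ nb a x ∧ ¬ QQ nb a y ∧ ¬ QQ nb z x ∧
    ¬ QQ nb z y

open Classical in
/-- finset of good tuples -/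
noncomputable def goodSet (nb : C → V → D → V) : Finset (C × V × V × V × V) :=
  Finset.univ.filter (fun w => Good nb w.1 w.2.1 w.2.2.1 w.2.2.2.1 w.2.2.2.2)

open Classical in
lemma mem_goodSet {nb : C → V → D → V} {w : C × V × V × V × V} :
    w ∈ goodSet nb ↔ Good nb w.1 w.2.1 w.2.2.1 w.2.2.2.1 w.2.2.2.2 := by
  simp [goodSet]

/-- underlying quadruple -/
def quad (w : C × V × V × V × V) : Finset V := {w.2.1, w.2.2.1, w.2.2.2.1, w.2.2.2.2}

/-- the hypergraph -/
noncomputable def HH (nb : C → V → D → V) : Finset (Finset V) := (goodSet nb).image quad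


lemma HH_card4 (nb : C → V → D → V) : ∀ e ∈ HH nb, e.card = 4 := by
  classical
  intro e he
  simp only [HH, goodSet, Finset.mem_image, Finset.mem_filter, Finset.mem_univ, true_and] at he
  obtain ⟨⟨i, a, z, x, y⟩, h, rfl⟩ := he
  obtain ⟨-, -, h1, h2, h3, h4, h5, h6⟩ := h
  simp only [QQ, not_or] at *
  simp only [quad]
  rw [Finset.card_insert_of_notMem, Finset.card_insert_of_notMem, Finset.card_insert_of_notMem,
    Finset.card_singleton] <;> simp <;> tauto

lemma QQ_symm {nb : C → V → D → V} (hs : ∀ i a z, EE nb i a z → EE nb i z a) {a x : V}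
    (h : QQ nb a x) : QQ nb x a := by
  rcases h with h | ⟨i, h⟩
  · exact Or.inl h.symm
  · exact Or.inr ⟨i, hs _ _ _ h⟩

/-- in an edge of HH -/
lemma mem_HH_cases {nb : C → V → D → V} (hs : ∀ i a z, EE nb i a z → EE nb i z a)
    {a x y z : V} (hax : a ≠ x) (hay : a ≠ y) (haz : a ≠ z) (hxy : x ≠ y) (hxz : x ≠ z)
    (hyz : y ≠ z) (h : ({a, x, y, z} : Finset V) ∈ HH nb) :
    ∃ i, Good nb i a x y z ∨ Good nb i a y x z ∨ Good nb i a z x y := by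
  classical
  simp only [HH, goodSet, Finset.mem_image, Finset.mem_filter, Finset.mem_univ, true_and] at h
  obtain ⟨⟨i, p, q, r, s⟩, h, he⟩ := h
  refine ⟨i, ?_⟩
  simp only [quad] at he h
  have key : ∀ p q r s, Good nb i p q r s → ({p, q, r, s} : Finset V) = {a, x, y, z} → p = a →
      Good nb i a x y z ∨ Good nb i a y x z ∨ Good nb i a z x y := by
    clear h he p q r s
    intro p q r s h he hp
    subst hp
    have flip : ∀ u v w, Good nb i p u v w → Good nb i p u w v := by
      rintro u v w ⟨h1, h2, h3, h4, h5, h6, h7, h8⟩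
      exact ⟨h1, hs _ _ _ h2, h3, h4.symm, h6, h5, h8, h7⟩
    have hx : x ∈ ({p, q, r, s} : Finset V) := by rw [he]; simp
    have hy : y ∈ ({p, q, r, s} : Finset V) := by rw [he]; simp
    have hz : z ∈ ({p, q, r, s} : Finset V) := by rw [he]; simp
    simp only [Finset.mem_insert, Finset.mem_singleton] at hx hy hz
    have hf := flip _ _ _ h
    rcases hx with hx | hx | hx | hx <;> rcases hy with hy | hy | hy | hy <;>
      rcases hz with hz | hz | hz | hz <;> subst hx <;> first
        | (exact absurd rfl hax)
        | skip
    all_goals subst hy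
    all_goals first
      | (exact absurd rfl hay)
      | (exact absurd rfl hxy)
      | skip
    all_goals subst hz
    all_goals first
      | (exact absurd rfl haz)
      | (exact absurd rfl hxz)
      | (exact absurd rfl hyz)
      | tauto
  have ha : a ∈ ({p, q, r, s} : Finset V) := by rw [he]; simp
  simp only [Finset.mem_insert, Finset.mem_singleton] at ha
  obtain ⟨h1, h2, h3, h4, h5, h6, h7, h8⟩ := h
  have qs : ∀ {u v}, ¬ QQ nb u v → ¬ QQ nb v u := fun h h' => h (QQ_symm hs h')
  rcases ha with ha | ha | ha | ha
  · exact key p q r s ⟨h1, h2, h3, h4, h5, h6, h7, h8⟩ he ha.symm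
  · refine key q p r s ⟨hs _ _ _ h1, h2, h3.symm, h4, h7, h8, h5, h6⟩ ?_ ha.symm
    rw [← he]; ext u; simp; tauto
  · refine key r s p q ⟨h2, h1, h4, h3, qs h5, qs h7, qs h6, qs h8⟩ ?_ ha.symm
    rw [← he]; ext u; simp; tauto
  · refine key s r p q ⟨hs _ _ _ h2, h1, h4.symm, h3, qs h6, qs h8, qs h5, qs h7⟩ ?_ ha.symm
    rw [← he]; ext u; simp; tauto

lemma fiber_le {nb : C → V → D → V} (hs : ∀ i a z, EE nb i a z → EE nb i z a)
    (hu : ∀ i j a z, EE nb i a z → EE nb j a z → i = j) :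
    (goodSet nb).card ≤ 8 * (HH nb).card := by
  classical
  refine Finset.card_le_mul_card_image _ _ ?_
  intro e he
  obtain ⟨⟨i, p, q, r, s⟩, hw, rfl⟩ := Finset.mem_image.1 he
  have hg : Good nb i p q r s := mem_goodSet.1 hw
  have hsub : (goodSet nb).filter (fun w => quad w = quad (i, p, q, r, s)) ⊆
      {(i, p, q, r, s), (i, p, q, s, r), (i, q, p, r, s), (i, q, p, s, r),
       (i, r, s, p, q), (i, r, s, q, p), (i, s, r, p, q), (i, s, r, q, p)} := by
    rintro ⟨j, a, z, x, y⟩ hm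
    rw [Finset.mem_filter, mem_goodSet] at hm
    simp only [quad] at hm
    obtain ⟨⟨g1, g2, g3, g4, g5, g6, g7, g8⟩, he⟩ := hm
    obtain ⟨h1, h2, h3, h4, h5, h6, h7, h8⟩ := hg
    have h1' := hs _ _ _ h1
    have h2' := hs _ _ _ h2
    have qs : ∀ {u v}, ¬ QQ nb u v → ¬ QQ nb v u := fun h h' => h (QQ_symm hs h')
    have n1 : ∀ {u v}, ¬ QQ nb u v → ¬ EE nb j u v := fun h h' => h (Or.inr ⟨_, h'⟩)
    have n2 : ∀ {u v}, ¬ QQ nb u v → u ≠ v := fun h h' => h (Or.inl h')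
    have ha : a ∈ ({p, q, r, s} : Finset V) := by rw [← he]; simp
    have hz : z ∈ ({p, q, r, s} : Finset V) := by rw [← he]; simp
    have hx : x ∈ ({p, q, r, s} : Finset V) := by rw [← he]; simp
    have hy : y ∈ ({p, q, r, s} : Finset V) := by rw [← he]; simp
    simp only [Finset.mem_insert, Finset.mem_singleton] at ha hz hx hy
    have a1 := n2 g5
    have a2 := n2 g6
    have a3 := n2 g7
    have a4 := n2 g8
    have b1 := n1 h5
    have b2 := n1 h6
    have b3 := n1 h7
    have b4 := n1 h8
    have b5 := n1 (qs h5)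
    have b6 := n1 (qs h6)
    have b7 := n1 (qs h7)
    have b8 := n1 (qs h8)
    have hpair : (a = p ∧ z = q) ∨ (a = q ∧ z = p) ∨ (a = r ∧ z = s) ∨ (a = s ∧ z = r) := by
      rcases ha with rfl | rfl | rfl | rfl <;> rcases hz with rfl | rfl | rfl | rfl <;> first
        | exact absurd rfl g3
        | exact absurd g1 b1
        | exact absurd g1 b2
        | exact absurd g1 b3
        | exact absurd g1 b4
        | exact absurd g1 b5
        | exact absurd g1 b6
        | exact absurd g1 b7
        | exact absurd g1 b8
        | exact Or.inl ⟨rfl, rfl⟩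
        | exact Or.inr (Or.inl ⟨rfl, rfl⟩)
        | exact Or.inr (Or.inr (Or.inl ⟨rfl, rfl⟩))
        | exact Or.inr (Or.inr (Or.inr ⟨rfl, rfl⟩))
    have hij : j = i := by
      rcases hpair with ⟨rfl, rfl⟩ | ⟨rfl, rfl⟩ | ⟨rfl, rfl⟩ | ⟨rfl, rfl⟩
      · exact hu _ _ _ _ g1 h1
      · exact hu _ _ _ _ g1 h1'
      · exact hu _ _ _ _ g1 h2
      · exact hu _ _ _ _ g1 h2'
    subst hij
    simp only [Finset.mem_insert, Finset.mem_singleton, Prod.mk.injEq, true_and]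
    clear qs n1 n2 g1 g2 b1 b2 b3 b4 b5 b6 b7 b8 h1 h2 h1' h2' h5 h6 h7 h8 g5 g6 g7 g8 he ha hz hs hu hw
    rcases hpair with ⟨rfl, rfl⟩ | ⟨rfl, rfl⟩ | ⟨rfl, rfl⟩ | ⟨rfl, rfl⟩ <;>
      rcases hx with rfl | rfl | rfl | rfl <;> rcases hy with rfl | rfl | rfl | rfl <;> first
        | exact absurd rfl g4
        | exact absurd rfl a1
        | exact absurd rfl a2
        | exact absurd rfl a3
        | exact absurd rfl a4
        | simp
  refine (Finset.card_le_card hsub).trans ?_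
  refine (Finset.card_insert_le _ _).trans ?_
  refine Nat.succ_le_succ ((Finset.card_insert_le _ _).trans ?_)
  exact Nat.succ_le_succ Finset.card_le_six

lemma HH_free {nb : C → V → D → V} (hs : ∀ i a z, EE nb i a z → EE nb i z a)
    (hu : ∀ i j a z, EE nb i a z → EE nb j a z → i = j) (t : ℕ)
    (hc : ∀ a b, a ≠ b → ∀ w : Fin t → V, Function.Injective w →
      ¬ ∀ j, ∃ i, EE nb i a (w j) ∧ EE nb i b (w j)) : ¬ hasK2t4 t (HH nb) := by
  classical
  rintro ⟨a, b, x, y, z, hcard, hE⟩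
  let f : Bool ⊕ (Fin t × Fin 3) → V := fun u => match u with
    | Sum.inl true => a
    | Sum.inl false => b
    | Sum.inr (j, 0) => x j
    | Sum.inr (j, 1) => y j
    | Sum.inr (j, 2) => z j
  have himg : Finset.univ.image f = ({a, b} ∪ Finset.image x Finset.univ ∪
      Finset.image y Finset.univ ∪ Finset.image z Finset.univ) := by
    ext v
    simp only [Finset.mem_image, Finset.mem_univ, true_and, Finset.mem_union, Finset.mem_insert,
      Finset.mem_singleton, Sum.exists, Bool.exists_bool, Prod.exists]
    constructor
    · rintro ((h | h) | ⟨j, c, h⟩)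
      · exact Or.inl (Or.inl (Or.inl (Or.inr h.symm)))
      · exact Or.inl (Or.inl (Or.inl (Or.inl h.symm)))
      · fin_cases c
        · exact Or.inl (Or.inl (Or.inr ⟨j, h⟩))
        · exact Or.inl (Or.inr ⟨j, h⟩)
        · exact Or.inr ⟨j, h⟩
    · rintro ((((h | h) | ⟨j, h⟩) | ⟨j, h⟩) | ⟨j, h⟩)
      · exact Or.inl (Or.inr h.symm)
      · exact Or.inl (Or.inl h.symm)
      · exact Or.inr ⟨j, 0, h⟩
      · exact Or.inr ⟨j, 1, h⟩
      · exact Or.inr ⟨j, 2, h⟩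
  have hinj : Function.Injective f := by
    have : (Finset.univ.image f).card = (Finset.univ : Finset (Bool ⊕ (Fin t × Fin 3))).card := by
      rw [himg, hcard]; simp; ring
    have := Finset.card_image_iff.1 this
    simpa using this
  have hab : a ≠ b := fun h => by
    have := @hinj (Sum.inl true) (Sum.inl false) h; simp at this
  have key : ∀ j, ∃ c : Fin 3, ∃ i, EE nb i a (f (Sum.inr (j, c))) ∧
      EE nb i b (f (Sum.inr (j, c))) := by
    intro j
    have ne : ∀ u v, u ≠ v → f u ≠ f v := fun u v h h' => h (hinj h')
    have ax : a ≠ x j := ne (Sum.inl true) (Sum.inr (j, 0)) (by simp)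
    have ay : a ≠ y j := ne (Sum.inl true) (Sum.inr (j, 1)) (by simp)
    have az : a ≠ z j := ne (Sum.inl true) (Sum.inr (j, 2)) (by simp)
    have bx : b ≠ x j := ne (Sum.inl false) (Sum.inr (j, 0)) (by simp)
    have bY : b ≠ y j := ne (Sum.inl false) (Sum.inr (j, 1)) (by simp)
    have bz : b ≠ z j := ne (Sum.inl false) (Sum.inr (j, 2)) (by simp)
    have xy : x j ≠ y j := ne (Sum.inr (j, 0)) (Sum.inr (j, 1)) (by simp)
    have xz : x j ≠ z j := ne (Sum.inr (j, 0)) (Sum.inr (j, 2)) (by simp)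
    have yz : y j ≠ z j := ne (Sum.inr (j, 1)) (Sum.inr (j, 2)) (by simp)
    obtain ⟨i, hi⟩ := mem_HH_cases hs ax ay az xy xz yz (hE j).1
    obtain ⟨i', hi'⟩ := mem_HH_cases hs bx bY bz xy xz yz (hE j).2
    have n1 : ∀ {u v l}, ¬ QQ nb u v → EE nb l u v → False := fun h h' => h (Or.inr ⟨_, h'⟩)
    have n2 : ∀ {u v l}, ¬ QQ nb u v → EE nb l v u → False :=
      fun h h' => h (Or.inr ⟨_, hs _ _ _ h'⟩)
    rcases hi with ⟨h1, h2, h3, h4, h5, h6, h7, h8⟩ | ⟨h1, h2, h3, h4, h5, h6, h7, h8⟩ |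
      ⟨h1, h2, h3, h4, h5, h6, h7, h8⟩ <;>
    rcases hi' with ⟨g1, g2, g3, g4, g5, g6, g7, g8⟩ | ⟨g1, g2, g3, g4, g5, g6, g7, g8⟩ |
      ⟨g1, g2, g3, g4, g5, g6, g7, g8⟩
    · obtain rfl := hu _ _ _ _ h2 g2
      exact ⟨0, i, h1, g1⟩
    · exact absurd g2 (n1 h8)
    · exact absurd g2 (n1 h7)
    · exact absurd h2 (n1 g8)
    · obtain rfl := hu _ _ _ _ h2 g2
      exact ⟨1, i, h1, g1⟩
    · exact absurd g2 (n2 h7)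
    · exact absurd h2 (n1 g7)
    · exact absurd h2 (n2 g7)
    · obtain rfl := hu _ _ _ _ h2 g2
      exact ⟨2, i, h1, g1⟩
  choose c hc' using key
  refine hc a b hab (fun j => f (Sum.inr (j, c j))) ?_ hc'
  intro j j' h
  have := hinj h
  simp at this
  exact this.1

lemma count {nb : C → V → D → V} (hs : ∀ i a z, EE nb i a z → EE nb i z a)
    (hinj : ∀ i a, Function.Injective (nb i a)) :
    Fintype.card C * (Fintype.card V * Fintype.card D) ^ 2 ≤ (goodSet nb).card +
      (2 * (Fintype.card C * (Fintype.card V * (Fintype.card V * Fintype.card D))) +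
      4 * (Fintype.card C * (Fintype.card V * (Fintype.card D *
        ((Fintype.card C * Fintype.card D + 1) * Fintype.card D))))) := by
  classical
  let Om : Finset (C × V × V × V × V) := Finset.univ.filter
    (fun w => EE nb w.1 w.2.1 w.2.2.1 ∧ EE nb w.1 w.2.2.2.1 w.2.2.2.2)
  let B1 := Om.filter (fun w => w.2.1 = w.2.2.1)
  let B2 := Om.filter (fun w => w.2.2.2.1 = w.2.2.2.2)
  let B3 := Om.filter (fun w => QQ nb w.2.1 w.2.2.2.1)
  let B4 := Om.filter (fun w => QQ nb w.2.1 w.2.2.2.2)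
  let B5 := Om.filter (fun w => QQ nb w.2.2.1 w.2.2.2.1)
  let B6 := Om.filter (fun w => QQ nb w.2.2.1 w.2.2.2.2)
  have hOm : Fintype.card C * (Fintype.card V * Fintype.card D) ^ 2 ≤ Om.card := by
    let g : C × (V × D) × (V × D) → C × V × V × V × V := fun w =>
      (w.1, w.2.1.1, nb w.1 w.2.1.1 w.2.1.2, w.2.2.1, nb w.1 w.2.2.1 w.2.2.2)
    have hg : Function.Injective g := by
      rintro ⟨i, ⟨a, d⟩, ⟨x, e⟩⟩ ⟨i', ⟨a', d'⟩, ⟨x', e'⟩⟩ h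
      simp only [g, Prod.mk.injEq] at h
      obtain ⟨rfl, rfl, h1, rfl, h2⟩ := h
      rw [hinj _ _ h1, hinj _ _ h2]
    have : (Finset.univ.image g) ⊆ Om := by
      intro w hw
      obtain ⟨u, -, rfl⟩ := Finset.mem_image.1 hw
      simp only [Om, Finset.mem_filter, Finset.mem_univ, true_and, g]
      exact ⟨⟨_, rfl⟩, ⟨_, rfl⟩⟩
    calc _ = (Finset.univ.image g).card := by
          rw [Finset.card_image_of_injective _ hg]; simp only [Finset.card_univ, Fintype.card_prod]; ring
      _ ≤ _ := Finset.card_le_card this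
  have hsub : Om ⊆ goodSet nb ∪ (B1 ∪ B2 ∪ B3 ∪ B4 ∪ B5 ∪ B6) := by
    intro w hw
    have hw' := hw
    simp only [Om, Finset.mem_filter, Finset.mem_univ, true_and] at hw'
    simp only [B1, B2, B3, B4, B5, B6, mem_goodSet, Good, Finset.mem_union, Finset.mem_filter,
      true_and, hw]
    by_contra hh
    simp only [not_or] at hh
    obtain ⟨h0, ⟨⟨⟨⟨h1, h2⟩, h3⟩, h4⟩, h5⟩, h6⟩ := hh
    exact h0 ⟨hw'.1, hw'.2, h1, h2, h3, h4, h5, h6⟩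
  have h1 : B1.card ≤ Fintype.card C * (Fintype.card V * (Fintype.card V * Fintype.card D)) := by
    let g : C × V × V × D → C × V × V × V × V := fun w =>
      (w.1, w.2.1, w.2.1, w.2.2.1, nb w.1 w.2.2.1 w.2.2.2)
    have : B1 ⊆ Finset.univ.image g := by
      rintro ⟨i, a, z, x, y⟩ hw
      simp only [B1, Om, Finset.mem_filter, Finset.mem_univ, true_and] at hw
      obtain ⟨⟨-, ⟨d, rfl⟩⟩, rfl⟩ := hw
      exact Finset.mem_image.2 ⟨(i, a, x, d), Finset.mem_univ _, rfl⟩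
    refine (Finset.card_le_card this).trans (Finset.card_image_le.trans ?_)
    simp
  have h3 : B3.card ≤ Fintype.card C * (Fintype.card V * (Fintype.card D *
        ((Fintype.card C * Fintype.card D + 1) * Fintype.card D))) := by
    let nx : V → Option (C × D) → V := fun a o => o.elim a (fun u => nb u.1 a u.2)
    let g : C × V × D × Option (C × D) × D → C × V × V × V × V := fun w =>
      (w.1, w.2.1, nb w.1 w.2.1 w.2.2.1, nx w.2.1 w.2.2.2.1,
        nb w.1 (nx w.2.1 w.2.2.2.1) w.2.2.2.2)
    have : B3 ⊆ Finset.univ.image g := by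
      rintro ⟨i, a, z, x, y⟩ hw
      simp only [B3, Om, Finset.mem_filter, Finset.mem_univ, true_and] at hw
      obtain ⟨⟨⟨d, rfl⟩, ⟨d', rfl⟩⟩, h⟩ := hw
      rcases h with rfl | ⟨j, e, rfl⟩
      · exact Finset.mem_image.2 ⟨(i, a, d, none, d'), Finset.mem_univ _, rfl⟩
      · exact Finset.mem_image.2 ⟨(i, a, d, some (j, e), d'), Finset.mem_univ _, rfl⟩
    refine (Finset.card_le_card this).trans (Finset.card_image_le.trans ?_)
    simp
  have h2 : B2.card ≤ B1.card := by
    refine Finset.card_le_card_of_injOn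
      (fun w => (w.1, w.2.2.2.1, w.2.2.2.2, w.2.1, w.2.2.1)) ?_ ?_
    · rintro ⟨i, a, z, x, y⟩ hw
      simp only [B1, B2, Om, Finset.coe_filter, Finset.mem_filter, Finset.mem_univ, true_and,
        Set.mem_ofPred_eq] at hw ⊢
      tauto
    · rintro ⟨i, a, z, x, y⟩ - ⟨i', a', z', x', y'⟩ - h
      simp only [Prod.mk.injEq] at h ⊢; tauto
  have h4 : B4.card ≤ B3.card := by
    refine Finset.card_le_card_of_injOn
      (fun w => (w.1, w.2.1, w.2.2.1, w.2.2.2.2, w.2.2.2.1)) ?_ ?_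
    · rintro ⟨i, a, z, x, y⟩ hw
      simp only [B3, B4, Om, Finset.coe_filter, Finset.mem_filter, Finset.mem_univ, true_and,
        Set.mem_ofPred_eq] at hw ⊢
      exact ⟨⟨hw.1.1, hs _ _ _ hw.1.2⟩, hw.2⟩
    · rintro ⟨i, a, z, x, y⟩ - ⟨i', a', z', x', y'⟩ - h
      simp only [Prod.mk.injEq] at h ⊢; tauto
  have h5 : B5.card ≤ B3.card := by
    refine Finset.card_le_card_of_injOn
      (fun w => (w.1, w.2.2.1, w.2.1, w.2.2.2.1, w.2.2.2.2)) ?_ ?_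
    · rintro ⟨i, a, z, x, y⟩ hw
      simp only [B3, B5, Om, Finset.coe_filter, Finset.mem_filter, Finset.mem_univ, true_and,
        Set.mem_ofPred_eq] at hw ⊢
      exact ⟨⟨hs _ _ _ hw.1.1, hw.1.2⟩, hw.2⟩
    · rintro ⟨i, a, z, x, y⟩ - ⟨i', a', z', x', y'⟩ - h
      simp only [Prod.mk.injEq] at h ⊢; tauto
  have h6 : B6.card ≤ B4.card := by
    refine Finset.card_le_card_of_injOn
      (fun w => (w.1, w.2.2.1, w.2.1, w.2.2.2.1, w.2.2.2.2)) ?_ ?_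
    · rintro ⟨i, a, z, x, y⟩ hw
      simp only [B6, B4, Om, Finset.coe_filter, Finset.mem_filter, Finset.mem_univ, true_and,
        Set.mem_ofPred_eq] at hw ⊢
      exact ⟨⟨hs _ _ _ hw.1.1, hw.1.2⟩, hw.2⟩
    · rintro ⟨i, a, z, x, y⟩ - ⟨i', a', z', x', y'⟩ - h
      simp only [Prod.mk.injEq] at h ⊢; tauto
  have hU := Finset.card_le_card hsub
  have u0 := Finset.card_union_le (goodSet nb) (B1 ∪ B2 ∪ B3 ∪ B4 ∪ B5 ∪ B6)
  have u1 := Finset.card_union_le (B1 ∪ B2 ∪ B3 ∪ B4 ∪ B5) B6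
  have u2 := Finset.card_union_le (B1 ∪ B2 ∪ B3 ∪ B4) B5
  have u3 := Finset.card_union_le (B1 ∪ B2 ∪ B3) B4
  have u4 := Finset.card_union_le (B1 ∪ B2) B3
  have u5 := Finset.card_union_le B1 B2
  omega

end abstractPart

section concretePart

variable (L M I : ℕ)

/-- the neighbour function -/
def nbc (i : Fin I) (a : Fin L × ZMod M) (d : Fin L) : Fin L × ZMod M :=
  (d, ((a.1 : ℕ) : ZMod M) * ((d : ℕ) : ZMod M) +
    (L : ZMod M) * ((i : ℕ) : ZMod M) * (((a.1 : ℕ) : ZMod M) + ((d : ℕ) : ZMod M) + 1) - a.2)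

variable {L M I}

lemma EE_iff (i : Fin I) (a z : Fin L × ZMod M) : EE (nbc L M I) i a z ↔
    a.2 + z.2 = ((a.1 : ℕ) : ZMod M) * ((z.1 : ℕ) : ZMod M) +
    (L : ZMod M) * ((i : ℕ) : ZMod M) * (((a.1 : ℕ) : ZMod M) + ((z.1 : ℕ) : ZMod M) + 1) := by
  constructor
  · rintro ⟨d, rfl⟩
    simp only [nbc]
    ring
  · intro h
    refine ⟨z.1, ?_⟩
    refine Prod.ext rfl ?_
    simp only [nbc]
    rw [← h]
    ring

lemma nbc_symm (i : Fin I) (a z : Fin L × ZMod M) (h : EE (nbc L M I) i a z) :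
    EE (nbc L M I) i z a := by
  rw [EE_iff] at h ⊢
  rw [add_comm, h]
  ring

lemma nbc_inj (i : Fin I) (a : Fin L × ZMod M) : Function.Injective (nbc L M I i a) := by
  intro d e h
  exact (Prod.ext_iff.1 h).1

lemma nbc_uniq (hM : ∀ m, 0 < m → m ≤ 2 * L → Nat.Coprime m M) (hI : I ≤ M) (i j : Fin I)
    (a z : Fin L × ZMod M) (h : EE (nbc L M I) i a z) (h' : EE (nbc L M I) j a z) : i = j := by
  rw [EE_iff] at h h'
  have ha := a.1.2
  have hz := z.1.2
  have u1 : IsUnit (L : ZMod M) := (ZMod.isUnit_iff_coprime _ _).2 (hM L (by omega) (by omega))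
  have u2 : IsUnit (((a.1 : ℕ) : ZMod M) + ((z.1 : ℕ) : ZMod M) + 1) := by
    have := (ZMod.isUnit_iff_coprime _ _).2
      (hM ((a.1 : ℕ) + (z.1 : ℕ) + 1) (by omega) (by omega))
    simpa using this
  have e := h.symm.trans h'
  have e2 := u1.mul_left_cancel (u2.mul_right_cancel (add_left_cancel e))
  rw [ZMod.natCast_eq_natCast_iff', Nat.mod_eq_of_lt (by omega), Nat.mod_eq_of_lt (by omega)] at e2
  exact Fin.ext e2

lemma unit_sub (hM : ∀ m, 0 < m → m ≤ 2 * L → Nat.Coprime m M) (a b : Fin L) (hab : a ≠ b) :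
    IsUnit (((a : ℕ) : ZMod M) - ((b : ℕ) : ZMod M)) := by
  have ha := a.2
  have hb := b.2
  have hne : (a : ℕ) ≠ b := fun h => hab (Fin.ext h)
  rcases lt_or_gt_of_ne hne with h | h
  · have := (ZMod.isUnit_iff_coprime _ _).2 (hM ((b : ℕ) - a) (by omega) (by omega))
    rw [Nat.cast_sub h.le] at this
    rw [← neg_sub]
    exact this.neg
  · have := (ZMod.isUnit_iff_coprime _ _).2 (hM ((a : ℕ) - b) (by omega) (by omega))
    rwa [Nat.cast_sub h.le] at this

lemma nbc_codeg (hM : ∀ m, 0 < m → m ≤ 2 * L → Nat.Coprime m M) (k : ℕ)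
    (hI : L * I ≤ k * M) (a b : Fin L × ZMod M) (hab : a ≠ b)
    (w : Fin (k + 1) → Fin L × ZMod M) (hw : Function.Injective w) :
    ¬ ∀ j, ∃ i, EE (nbc L M I) i a (w j) ∧ EE (nbc L M I) i b (w j) := by
  intro h
  choose c hc using h
  have hc1 := fun j => (hc j).1
  have hc2 := fun j => (hc j).2
  simp only [EE_iff] at hc1 hc2
  let N : Fin (k + 1) → ℕ := fun j => ((w j).1 : ℕ) + L * (c j : ℕ)
  have hN : ∀ j, (((a.1 : ℕ) : ZMod M) - ((b.1 : ℕ) : ZMod M)) * ((N j : ℕ) : ZMod M) =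
      a.2 - b.2 := by
    intro j
    have e1 := hc1 j
    have e2 := hc2 j
    simp only [N]
    push_cast
    linear_combination e2 - e1
  by_cases h1 : a.1 = b.1
  · have := hN 0
    rw [h1, sub_self, zero_mul] at this
    exact hab (Prod.ext h1 (sub_eq_zero.1 this.symm))
  · have hu := unit_sub hM a.1 b.1 h1
    have hcong : ∀ j j', N j % M = N j' % M := by
      intro j j'
      rw [← ZMod.natCast_eq_natCast_iff']
      exact hu.mul_left_cancel ((hN j).trans (hN j').symm)
    have hlt : ∀ j, N j < k * M := by
      intro j
      have h2 := (w j).1.2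
      have h3 := (c j).2
      have h4 : L * ((c j : ℕ) + 1) ≤ L * I := Nat.mul_le_mul_left _ h3
      rw [mul_add] at h4
      simp only [N]
      omega
    let f : Fin (k + 1) → Fin k := fun j => ⟨N j / M, Nat.div_lt_of_lt_mul (by
      rw [mul_comm]; exact hlt j)⟩
    obtain ⟨j, j', hne, hf⟩ := Fintype.exists_ne_map_eq_of_card_lt f (by simp)
    have hd : N j / M = N j' / M := by simpa [f] using hf
    have hNN : N j = N j' := by
      rw [← Nat.div_add_mod (N j) M, ← Nat.div_add_mod (N j') M, hd, hcong j j']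
    have hL : 0 < L := lt_of_le_of_lt (Nat.zero_le _) a.1.2
    have hm : (w j).1 = (w j').1 := by
      have : N j % L = N j' % L := by rw [hNN]
      simp only [N, Nat.add_mul_mod_self_left] at this
      rw [Nat.mod_eq_of_lt (w j).1.2, Nat.mod_eq_of_lt (w j').1.2] at this
      exact Fin.ext this
    have hcc : c j = c j' := by
      have : L * (c j : ℕ) = L * (c j' : ℕ) := by
        have := hNN
        simp only [N, hm] at this
        omega
      exact Fin.ext (Nat.eq_of_mul_eq_mul_left hL this)
    apply hne
    apply hw
    refine Prod.ext hm ?_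
    have e1 := hc1 j
    have e2 := hc1 j'
    rw [hcc, hm, ← e2] at e1
    exact add_left_cancel e1

/-- main finite statement -/
lemma finite_main (k : ℕ) [NeZero M] (hM : ∀ m, 0 < m → m ≤ 2 * L → Nat.Coprime m M)
    (hIM : I ≤ M) (hI : L * I ≤ k * M) :
    ∃ H : Finset (Finset (Fin L × ZMod M)), (∀ e ∈ H, e.card = 4) ∧ ¬ hasK2t4 (k + 1) H ∧
      I * (L * M * L) ^ 2 ≤ 8 * H.card + (2 * (I * (L * M * (L * M * L))) +
        4 * (I * (L * M * (L * ((I * L + 1) * L))))) := by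
  refine ⟨HH (nbc L M I), HH_card4 _, HH_free nbc_symm (nbc_uniq hM hIM) _ ?_, ?_⟩
  · intro a b hab w hw
    exact nbc_codeg hM k hI a b hab w hw
  · have h1 := count (nb := nbc L M I) nbc_symm nbc_inj
    have h2 := fiber_le (nb := nbc L M I) nbc_symm (nbc_uniq hM hIM)
    simp only [Fintype.card_prod, Fintype.card_fin, ZMod.card] at h1
    omega

end concretePart

lemma transport {V : Type} [Fintype V] [DecidableEq V] (n t : ℕ) (ht : 0 < t)
    (hn : Fintype.card V ≤ n) (H : Finset (Finset V)) (h4 : ∀ e ∈ H, e.card = 4)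
    (hH : ¬ hasK2t4 t H) : ∃ H' : Finset (Finset (Fin n)), (∀ e ∈ H', e.card = 4) ∧
      ¬ hasK2t4 t H' ∧ H'.card = H.card := by
  obtain ⟨f⟩ : Nonempty (V ↪ Fin n) := Function.Embedding.nonempty_of_card_le (by simpa using hn)
  refine ⟨H.image (Finset.map f), ?_, ?_, Finset.card_image_of_injective _ (Finset.map_injective f)⟩
  · intro e he
    obtain ⟨e', he', rfl⟩ := Finset.mem_image.1 he
    rw [Finset.card_map]
    exact h4 _ he'
  · rintro ⟨a, b, x, y, z, hc, hE⟩
    apply hH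
    have hr : ∀ e ∈ H.image (Finset.map f), ∀ v ∈ e, ∃ u, f u = v := by
      intro e he v hv
      obtain ⟨e', he', rfl⟩ := Finset.mem_image.1 he
      obtain ⟨u, -, hu⟩ := Finset.mem_map.1 hv
      exact ⟨u, hu⟩
    obtain ⟨a, rfl⟩ := hr _ (hE ⟨0, ht⟩).1 a (by simp)
    obtain ⟨b, rfl⟩ := hr _ (hE ⟨0, ht⟩).2 b (by simp)
    have hx : ∀ i, ∃ u, f u = x i := fun i => hr _ (hE i).1 _ (by simp)
    have hy : ∀ i, ∃ u, f u = y i := fun i => hr _ (hE i).1 _ (by simp)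
    have hz : ∀ i, ∃ u, f u = z i := fun i => hr _ (hE i).1 _ (by simp)
    choose x' hx using hx
    choose y' hy using hy
    choose z' hz using hz
    obtain rfl : (fun i => f (x' i)) = x := funext hx
    obtain rfl : (fun i => f (y' i)) = y := funext hy
    obtain rfl : (fun i => f (z' i)) = z := funext hz
    refine ⟨a, b, x', y', z', ?_, ?_⟩
    · rw [← hc, ← Finset.card_map f]
      congr 1
      ext v
      simp only [Finset.mem_map, Finset.mem_union, Finset.mem_image, Finset.mem_univ, true_and,
        Finset.mem_insert, Finset.mem_singleton]
      constructor
      · rintro ⟨u, (((rfl | rfl) | ⟨i, rfl⟩) | ⟨i, rfl⟩) | ⟨i, rfl⟩, rfl⟩ <;> simp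
      · rintro ((((rfl | rfl) | ⟨i, rfl⟩) | ⟨i, rfl⟩) | ⟨i, rfl⟩) <;> simp
    · intro i
      have key : ∀ u v w s : V, ({f u, f v, f w, f s} : Finset (Fin n)) ∈
          H.image (Finset.map f) → ({u, v, w, s} : Finset V) ∈ H := by
        intro u v w s h
        obtain ⟨e, he, h⟩ := Finset.mem_image.1 h
        have : e = {u, v, w, s} := by
          apply Finset.map_injective f
          rw [h]
          simp
        rwa [← this]
      exact ⟨key _ _ _ _ (hE i).1, key _ _ _ _ (hE i).2⟩

lemma real_bound (k L M I h δ : ℝ) (hk : 1 ≤ k) (hL : 0 < L) (hM : 1 ≤ M) (hI : 0 ≤ I)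
    (hc : I * (L * M * L) ^ 2 ≤ 8 * h + (2 * (I * (L * M * (L * M * L))) +
        4 * (I * (L * M * (L * ((I * L + 1) * L))))))
    (hI1 : L * I ≤ k * M) (hI2 : k * M ≤ L * (I + 1)) (hδ1 : δ ≤ 1)
    (h1 : 4 * k + 6 ≤ δ * L) (h2 : L ≤ δ * (k * M)) :
    k * (L * M) ^ 3 * (1 - δ) ^ 2 ≤ 8 * h := by
  have e1 : I * L + 1 ≤ (k + 1) * M := by nlinarith
  have e2 : 4 * (I * (L * M * (L * ((I * L + 1) * L)))) ≤
      4 * (I * (L * M * (L * (((k + 1) * M) * L)))) := by gcongr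
  have e3 : I * L ^ 3 * M ^ 2 * ((1 - δ) * L) ≤ I * L ^ 3 * M ^ 2 * (L - (4 * k + 6)) := by
    apply mul_le_mul_of_nonneg_left
    · linarith
    · positivity
  have e4 : k * M * (1 - δ) ≤ I * L := by nlinarith
  have e5 : (k * M * (1 - δ)) * (L ^ 3 * M ^ 2 * (1 - δ)) ≤
      (I * L) * (L ^ 3 * M ^ 2 * (1 - δ)) := by
    apply mul_le_mul_of_nonneg_right e4
    have : 0 ≤ 1 - δ := by linarith
    positivity
  nlinarith

lemma main_aux (k : ℕ) (hk : 1 ≤ k) (δ : ℝ) (hδ : 0 < δ) (hδ2 : δ ≤ 1 / 5) :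
    ∃ N : ℕ, ∀ n : ℕ, N ≤ n → ∃ H : Finset (Finset (Fin n)),
      (∀ e ∈ H, e.card = 4) ∧ ¬ hasK2t4 (k + 1) H ∧
      (k : ℝ) * (n : ℝ) ^ 3 * (1 - 5 * δ) ≤ 8 * (H.card : ℝ) := by
  obtain ⟨L0, hL0⟩ := exists_nat_ge ((4 * (k : ℝ) + 6) / δ)
  let L := L0 + k + 1
  have hLδ : 4 * (k : ℝ) + 6 ≤ δ * (L : ℝ) := by
    rw [div_le_iff₀ hδ] at hL0
    have : (L : ℝ) = L0 + k + 1 := by simp [L]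
    rw [this]
    have : (0 : ℝ) ≤ k := Nat.cast_nonneg k
    nlinarith
  have hkL : k ≤ L := by simp only [L]; omega
  have hL : 0 < L := by simp only [L]; omega
  clear_value L
  let P := L * (2 * L).factorial
  have hP : 0 < P := Nat.mul_pos hL (Nat.factorial_pos _)
  obtain ⟨N0, hN0⟩ := exists_nat_ge (((P : ℝ) + 2 * (L : ℝ) ^ 2) / δ)
  refine ⟨N0 + L, fun n hn => ?_⟩
  have hn0 : (P : ℝ) + 2 * (L : ℝ) ^ 2 ≤ δ * (n : ℝ) := by
    rw [div_le_iff₀ hδ] at hN0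
    have : (N0 : ℝ) ≤ n := by exact_mod_cast (by omega : N0 ≤ n)
    nlinarith
  let r := (n - L) / P
  let M := (2 * L).factorial * r + 1
  have hLM : L * M = L + P * r := by simp only [M, P]; ring
  have hr1 : P * r ≤ n - L := Nat.mul_div_le _ _
  have hr2 : n - L < P * r + P := by
    have := Nat.lt_mul_div_succ (n - L) hP
    rw [mul_add, mul_one] at this
    exact this
  have hup : L * M ≤ n := by omega
  have hlo : n ≤ L * M + P := by omega
  have hcop : ∀ m, 0 < m → m ≤ 2 * L → Nat.Coprime m M := by
    intro m h0 h1
    have hd : m ∣ (2 * L).factorial * r := (Nat.dvd_factorial h0 h1).mul_right r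
    obtain ⟨q, hq⟩ := hd
    simp only [M, hq]
    rw [mul_comm, Nat.coprime_mul_right_add_right]
    exact Nat.coprime_one_right m
  have hM1 : 1 ≤ M := by simp only [M]; omega
  have : NeZero M := ⟨by omega⟩
  clear_value M r
  let I := k * M / L
  have hI1 : L * I ≤ k * M := Nat.mul_div_le _ _
  have hI2 : k * M ≤ L * (I + 1) := (Nat.lt_mul_div_succ (k * M) hL).le
  have hIM : I ≤ M := by
    apply Nat.div_le_of_le_mul
    exact Nat.mul_le_mul_right _ hkL
  clear_value I
  obtain ⟨H, h4, hfree, hcount⟩ := finite_main (L := L) (M := M) (I := I) k hcop hIM hI1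
  obtain ⟨H', h4', hfree', hcard⟩ := transport n (k + 1) (by omega) (by
    simpa [ZMod.card] using hup) H h4 hfree
  refine ⟨H', h4', hfree', ?_⟩
  rw [hcard]
  have hLr : (0 : ℝ) < L := by exact_mod_cast hL
  have hkr : (1 : ℝ) ≤ k := by exact_mod_cast hk
  have hMr : (1 : ℝ) ≤ M := by exact_mod_cast hM1
  have hlor : (n : ℝ) ≤ L * M + P := by exact_mod_cast hlo
  have hnn : (0 : ℝ) ≤ n := Nat.cast_nonneg n
  have hbig : (1 - δ) * (n : ℝ) ≤ L * M := by nlinarith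
  have hsm : (L : ℝ) ≤ δ * (k * M) := by
    have h1 : (n : ℝ) / 2 ≤ L * M := by nlinarith
    have h2 : δ * ((n : ℝ) / 2) ≤ δ * (L * M) := mul_le_mul_of_nonneg_left h1 hδ.le
    have h3 : (0 : ℝ) ≤ P := Nat.cast_nonneg P
    have h4 : (L : ℝ) * L ≤ L * (δ * M) := by nlinarith
    have h5 : (L : ℝ) ≤ δ * M := le_of_mul_le_mul_left h4 hLr
    have h6 : (0 : ℝ) ≤ δ * M := by positivity
    nlinarith
  have hb := real_bound (k : ℝ) L M I H.card δ hkr hLr hMr (Nat.cast_nonneg _)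
    (by exact_mod_cast hcount) (by exact_mod_cast hI1) (by exact_mod_cast hI2) (by linarith)
    hLδ hsm
  refine le_trans ?_ hb
  have hδ1 : 0 ≤ 1 - δ := by linarith
  have hpow : ((1 - δ) * (n : ℝ)) ^ 3 ≤ (L * M : ℝ) ^ 3 :=
    pow_le_pow_left₀ (by positivity) hbig 3
  have hbern : 1 - 5 * δ ≤ (1 - δ) ^ 5 := by
    have := one_add_mul_le_pow (a := -δ) (by linarith) 5
    push_cast at this
    have e : (1 + -δ) = 1 - δ := by ring
    rw [e] at this
    linarith
  calc (k : ℝ) * (n : ℝ) ^ 3 * (1 - 5 * δ) ≤ (k : ℝ) * (n : ℝ) ^ 3 * (1 - δ) ^ 5 := by gcongr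
    _ = k * ((1 - δ) * (n : ℝ)) ^ 3 * (1 - δ) ^ 2 := by ring
    _ ≤ _ := by gcongr

end K2t4

theorem ex_K2t4_lower (t : ℕ) (ht : 2 ≤ t) (ε : ℝ) (hε : 0 < ε) :
    ∃ N : ℕ, ∀ n : ℕ, N ≤ n →
      ∃ H : Finset (Finset (Fin n)),
        (∀ e ∈ H, e.card = 4) ∧ ¬ hasK2t4 t H ∧
        (1 - ε) * (((t : ℝ) - 1) / 8) * (n : ℝ) ^ 3 ≤ (H.card : ℝ) := by
  obtain ⟨k, rfl⟩ : ∃ k, t = k + 1 := ⟨t - 1, by omega⟩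
  obtain ⟨N, hN⟩ := K2t4.main_aux k (by omega) (min ε 1 / 5)
    (by have : 0 < min ε 1 := lt_min hε one_pos
        linarith)
    (by have : min ε 1 ≤ 1 := min_le_right _ _
        linarith)
  refine ⟨N, fun n hn => ?_⟩
  obtain ⟨H, h1, h2, h3⟩ := hN n hn
  refine ⟨H, h1, h2, ?_⟩
  have hm : min ε 1 ≤ ε := min_le_left _ _
  have h5 : (k : ℝ) * (n : ℝ) ^ 3 * (1 - ε) ≤ (k : ℝ) * (n : ℝ) ^ 3 * (1 - 5 * (min ε 1 / 5)) := by
    apply mul_le_mul_of_nonneg_left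
    · linarith
    · positivity
  push_cast
  linarith
end

section
/- Let G be a graph and let H be the 4-uniform hypergraph whose edges are the 4-element vertex sets {a, b, c, d} such that ab and cd are edges of G while ac, ad, bc, bd are not edges of G (i.e., vertex sets of induced 2-matchings of G). If a, b, x, y, z are vertices with a ∉ {x,y,z}, b ∉ {x,y,z}, and both {a, x, y, z} and {b, x, y, z} are edges of H, then there exists c ∈ {x, y, z} such that ac and bc are both edges of G. -/
/-- The 4-uniform hypergraph associated to a graph `G`: its edges are the 4-element
vertex sets `{a, b, c, d}` such that `ab` and `cd` are edges of `G` while `ac`, `ad`,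
`bc`, `bd` are not (vertex sets of induced 2-matchings of `G`). -/
def induced2MatchingHypergraph {V : Type*} [DecidableEq V] (G : SimpleGraph V) :
    Set (Finset V) :=
  {s | ∃ a b c d : V, s = {a, b, c, d} ∧ s.card = 4 ∧
    G.Adj a b ∧ G.Adj c d ∧
    ¬ G.Adj a c ∧ ¬ G.Adj a d ∧ ¬ G.Adj b c ∧ ¬ G.Adj b d}

theorem i2m_aux {V : Type*} [DecidableEq V] (G : SimpleGraph V) (s : Finset V)
    (h : s ∈ induced2MatchingHypergraph G) :
    ∀ u ∈ s, ∃ v ∈ s, G.Adj u v ∧ ∀ w ∈ s, G.Adj u w → w = v := by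
  obtain ⟨p, q, r, t, rfl, -, h1, h2, h3, h4, h5, h6⟩ := h
  have e := fun u v => G.adj_comm u v
  have i := fun u => G.irrefl (v := u)
  intro u hu
  simp only [Finset.mem_insert, Finset.mem_singleton] at hu ⊢
  rcases hu with rfl | rfl | rfl | rfl
  · exact ⟨q, by simp, h1, by grind⟩
  · exact ⟨p, by simp, h1.symm, by grind⟩
  · exact ⟨t, by simp, h2, by grind⟩
  · exact ⟨r, by simp, h2.symm, by grind⟩

/-- Let `G` be a graph and let `H` be the 4-uniform hypergraph of induced 2-matchings
of `G`.  If `a, b ∉ {x, y, z}` and both `{a, x, y, z}` and `{b, x, y, z}` are edges of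
`H`, then some `c ∈ {x, y, z}` is adjacent in `G` to both `a` and `b`. -/
theorem induced2Matching_common_neighbor {V : Type*} [DecidableEq V]
    (G : SimpleGraph V) (a b x y z : V)
    (ha : a ≠ x ∧ a ≠ y ∧ a ≠ z) (hb : b ≠ x ∧ b ≠ y ∧ b ≠ z)
    (haH : ({a, x, y, z} : Finset V) ∈ induced2MatchingHypergraph G)
    (hbH : ({b, x, y, z} : Finset V) ∈ induced2MatchingHypergraph G) :
    ∃ c : V, (c = x ∨ c = y ∨ c = z) ∧ G.Adj a c ∧ G.Adj b c := by
  have A := i2m_aux G _ haH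
  have B := i2m_aux G _ hbH
  have e := fun u v => G.adj_comm u v
  have i := fun u => G.irrefl (v := u)
  simp only [Finset.mem_insert, Finset.mem_singleton] at A B
  obtain ⟨c, hc, hac, -⟩ := A a (by simp)
  have hca : c ≠ a := hac.ne'
  have hc' : c = x ∨ c = y ∨ c = z := by tauto
  refine ⟨c, hc', hac, ?_⟩
  obtain ⟨v, -, hv, hu⟩ := A c hc
  have hav := hu a (by simp) hac.symm
  obtain ⟨w, hw, hcw, -⟩ := B c (Or.inr hc')
  rcases hw with rfl | hw
  · exact hcw.symm
  · have := hu w (Or.inr hw) hcw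
    exfalso
    rcases hw with rfl | rfl | rfl <;> simp_all
end
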